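/- arXiv:1310.7066 — 5 statements merged into one kernel-verified Lean document; each statement's English description precedes it below -/
import Mathlib

section
/- Let r, c, t be positive integers and set rank(T) = ‖T‖ − c·(r choose 2) for T ∈ SSYT(r,c,t). Then the homology of the complex (C(r,c,t), d) is concentrated in even ranks: for every odd natural number m and every u in the 𝔽₂-span of {e_T : rank(T) = m} with d(u) = 0, there exists w in the 𝔽₂-span of {e_T : rank(T) = m+1} with d(w) = u. -/
/-- The semistandardness condition for a filling of the `r × c` rectangle with values in
`{0, …, r+t−1}`: rows weakly increase and columns strictly increase. -/
def SSYTCond (r c t : ℕ) (T : Fin r → Fin c → Fin (r + t)) : Prop :=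
  (∀ (i : Fin r) (j j' : Fin c), j ≤ j' → T i j ≤ T i j') ∧
  (∀ (i i' : Fin r) (j : Fin c), i < i' → T i j < T i' j)

instance (r c t : ℕ) : DecidablePred (SSYTCond r c t) := fun _ => by
  unfold SSYTCond; infer_instance

/-- `SSYT(r,c,t)`: semistandard Young tableaux of rectangular shape `r × c` with entries in
`{0, …, r+t−1}`; these index the basis of the chain complex `C(r,c,t)`. -/
abbrev SSYT (r c t : ℕ) : Type := {T : Fin r → Fin c → Fin (r + t) // SSYTCond r c t T}

/-- "`i = 0` or `T(i−1, j) ≠ v − 1`": the entry directly above position `(i,j)` (if any) is not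
`v − 1`. -/
abbrev NoAbove (r c t : ℕ) (T : Fin r → Fin c → Fin (r + t)) (i : Fin r) (j : Fin c)
    (v : ℕ) : Prop :=
  ∀ i' : Fin r, (i' : ℕ) + 1 = (i : ℕ) → (T i' j : ℕ) ≠ v - 1

/-- The number of columns `j` with `T(i,j) = v` and no `v − 1` directly above. -/
def decCount (r c t : ℕ) (T : Fin r → Fin c → Fin (r + t)) (i : Fin r) (v : ℕ) : ℕ :=
  (Finset.univ.filter fun j : Fin c => (T i j : ℕ) = v ∧ NoAbove r c t T i j v).card

/-- The filling obtained from `T` by replacing the leftmost entry equal to `v` in row `i`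
by `v − 1` (and leaving `T` unchanged if `v` does not occur in row `i`). -/
def replLeftmost (r c t : ℕ) (T : Fin r → Fin c → Fin (r + t)) (i : Fin r) (v : Fin (r + t)) :
    Fin r → Fin c → Fin (r + t) := fun i' j' =>
  if i' = i ∧ T i' j' = v ∧ ∀ j'' : Fin c, j'' < j' → T i' j'' ≠ v then
    ⟨(v : ℕ) - 1, Nat.lt_of_le_of_lt (Nat.sub_le _ _) v.2⟩
  else T i' j'

/-- The boundary map `d` of the complex `C(r,c,t)` over `𝔽₂`: `d(e_T) = ∑ e_{T'}`, summed over
pairs `(i, v)` with `v` odd such that the number of copies of `v` in row `i` without `v − 1`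
directly above is odd and the tableau `T'`, obtained by decrementing the leftmost `v` in
row `i`, is again semistandard. -/
noncomputable def dSSYT (r c t : ℕ) :
    (SSYT r c t →₀ ZMod 2) →ₗ[ZMod 2] (SSYT r c t →₀ ZMod 2) :=
  Finsupp.lift _ _ _ fun T : SSYT r c t =>
    ∑ i : Fin r, ∑ v : Fin (r + t),
      if h : Odd (v : ℕ) ∧ Odd (decCount r c t T.1 i (v : ℕ)) ∧
          SSYTCond r c t (replLeftmost r c t T.1 i v) then
        Finsupp.single (⟨replLeftmost r c t T.1 i v, h.2.2⟩ : SSYT r c t) (1 : ZMod 2)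
      else 0

/-- The sum of the entries of a tableau. -/
def normSSYT (r c t : ℕ) (T : SSYT r c t) : ℕ :=
  ∑ i : Fin r, ∑ j : Fin c, (T.1 i j : ℕ)

/-- A contracting homotopy for a differential over `𝔽₂` that is a sum of commuting partial
matchings `low s`, defined on `o s` and with image `e s`. -/
theorem exists_homotopy_of_commuting_matchings {X S : Type*} [Fintype S]
    (low : S → X → X) (o e : S → X → Prop) [∀ s x, Decidable (o s x)]
    (D : (X →₀ ZMod 2) →ₗ[ZMod 2] (X →₀ ZMod 2))
    (hD : ∀ x, D (Finsupp.single x 1) =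
      ∑ s, if o s x then Finsupp.single (low s x) (1 : ZMod 2) else 0)
    (hinj : ∀ s x y, o s x → o s y → low s x = low s y → x = y)
    (he : ∀ s x, o s x → e s (low s x))
    (hup : ∀ s x, e s x → ∃ y, o s y ∧ low s y = x)
    (hoe : ∀ s x, e s x → ¬ o s x)
    (ho' : ∀ s s' x, s ≠ s' → o s' x → (o s (low s' x) ↔ o s x))
    (he' : ∀ s s' x, s ≠ s' → o s' x → (e s (low s' x) ↔ e s x))
    (hcomm : ∀ s s' x, s ≠ s' → o s x → o s' x → low s (low s' x) = low s' (low s x)) :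
    ∃ H : (X →₀ ZMod 2) →ₗ[ZMod 2] (X →₀ ZMod 2), ∀ x, (∃ s, o s x ∨ e s x) →
      D (H (Finsupp.single x 1)) + H (D (Finsupp.single x 1)) = Finsupp.single x 1 ∧
      (H (Finsupp.single x 1) = 0 ∨
        ∃ s y, o s y ∧ low s y = x ∧ H (Finsupp.single x 1) = Finsupp.single y 1) := by
  classical
  have hup' : ∀ s x, ∃ y, e s x → o s y ∧ low s y = x := fun s x => by
    by_cases h : e s x
    · obtain ⟨y, hy⟩ := hup s x h
      exact ⟨y, fun _ => hy⟩
    · exact ⟨x, fun h' => absurd h' h⟩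
  choose up hup using hup'
  have uplow : ∀ s x, o s x → up s (low s x) = x := fun s x h =>
    hinj s _ _ (hup s _ (he s x h)).1 h (hup s _ (he s x h)).2
  by_cases hS : Nonempty S
  swap
  · exact ⟨0, fun x ⟨s, _⟩ => absurd ⟨s⟩ hS⟩
  let f : X → S := fun x => Classical.epsilon fun s => o s x ∨ e s x
  have hf : ∀ x, (∃ s, o s x ∨ e s x) → o (f x) x ∨ e (f x) x := fun x h =>
    Classical.epsilon_spec (p := fun s => o s x ∨ e s x) h
  have hflow : ∀ s x, o s x → f (low s x) = f x := fun s x h => by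
    have : (fun s' => o s' (low s x) ∨ e s' (low s x)) = fun s' => o s' x ∨ e s' x := by
      funext s'
      by_cases hs : s' = s
      · subst hs
        simp [h, he s' x h]
      · rw [ho' s' s x hs h, he' s' s x hs h]
    simp only [f, this]
  let H : (X →₀ ZMod 2) →ₗ[ZMod 2] (X →₀ ZMod 2) := Finsupp.lift _ _ _ fun x =>
    if e (f x) x then Finsupp.single (up (f x) x) (1 : ZMod 2) else 0
  have hH : ∀ x, H (Finsupp.single x 1) =
      if e (f x) x then Finsupp.single (up (f x) x) (1 : ZMod 2) else 0 := fun x => by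
    simp [H]
  refine ⟨H, fun x hx => ⟨?_, ?_⟩⟩
  · have key : ∀ s, s ≠ f x →
        (if e (f x) x then (if o s (up (f x) x) then
          Finsupp.single (low s (up (f x) x)) (1 : ZMod 2) else 0) else 0) =
        H (if o s x then Finsupp.single (low s x) (1 : ZMod 2) else 0) := by
      intro s hs
      by_cases hos : o s x
      · rw [if_pos hos, hH, hflow s x hos]
        by_cases hes : e (f x) x
        · obtain ⟨h1, h2⟩ := hup _ _ hes
          have h3 : o s (up (f x) x) := by
            rw [← ho' s (f x) _ hs h1, h2]
            exact hos
          rw [if_pos hes, if_pos h3, if_pos ((he' _ _ x hs.symm hos).2 hes)]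
          congr 1
          have h4 := uplow (f x) (low s (up (f x) x)) ((ho' _ _ _ hs.symm h3).2 h1)
          rw [← hcomm _ _ _ hs h3 h1, h2] at h4
          exact h4.symm
        · rw [if_neg hes, if_neg (mt (he' _ _ x hs.symm hos).1 hes)]
      · rw [if_neg hos, map_zero]
        by_cases hes : e (f x) x
        · obtain ⟨h1, h2⟩ := hup _ _ hes
          have h3 : ¬ o s (up (f x) x) := by
            rw [← ho' s (f x) _ hs h1, h2]
            exact hos
          rw [if_pos hes, if_neg h3]
        · rw [if_neg hes]
    have hDH : D (H (Finsupp.single x 1)) = ∑ s, if e (f x) x then (if o s (up (f x) x) then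
          Finsupp.single (low s (up (f x) x)) (1 : ZMod 2) else 0) else 0 := by
      rw [hH]
      split_ifs
      · rw [hD]
      · simp
    rw [hDH, hD, map_sum, ← Finset.sum_add_distrib, Finset.sum_eq_single (f x)]
    · rcases hf x hx with h | h
      · have h' : ¬ e (f x) x := fun h' => hoe _ _ h' h
        rw [if_neg h', if_pos h, hH, hflow _ _ h, if_pos (he _ _ h), uplow _ _ h, zero_add]
      · obtain ⟨h1, h2⟩ := hup _ _ h
        rw [if_pos h, if_pos h1, if_neg (hoe _ _ h), h2, map_zero, add_zero]
    · intro s _ hs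
      rw [key s hs]
      ext y
      exact CharTwo.add_self_eq_zero _
    · simp
  · rw [hH]
    split_ifs with h
    · exact Or.inr ⟨_, _, (hup _ _ h).1, (hup _ _ h).2, rfl⟩
    · exact Or.inl rfl

section Tableaux

open Finset

variable {r c t : ℕ} {T : Fin r → Fin c → Fin (r + t)} {i i' : Fin r} {j j₀ : Fin c}
  {v v' : Fin (r + t)}

/-- The columns whose entry in row `i` is `v - 1` and can be raised to `v`. -/
def raisable (T : Fin r → Fin c → Fin (r + t)) (i : Fin r) (v : ℕ) : Finset (Fin c) :=
  univ.filter fun j => (T i j : ℕ) + 1 = v ∧ ∀ i' : Fin r, (i : ℕ) + 1 = i' → (T i' j : ℕ) ≠ v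

/-- `j₀` is the column of the leftmost `v` in row `i` and has no `v - 1` above it. -/
structure IsLowerable (T : Fin r → Fin c → Fin (r + t)) (i : Fin r) (v : Fin (r + t))
    (j₀ : Fin c) : Prop where
  eq : T i j₀ = v
  left : ∀ j < j₀, T i j ≠ v
  above : NoAbove r c t T i j₀ v

theorem exists_isLowerable (hT : SSYTCond r c t T) (h : Odd (decCount r c t T i v)) :
    ∃ j₀, IsLowerable T i v j₀ := by
  have hne : decCount r c t T i v ≠ 0 := fun h0 => by simp [h0] at h
  obtain ⟨j, hj⟩ := Finset.card_pos.1 (Nat.pos_of_ne_zero hne)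
  simp only [Finset.mem_filter, Finset.mem_univ, true_and] at hj
  have hn : (univ.filter fun j : Fin c => T i j = v).Nonempty :=
    ⟨j, by simpa using Fin.ext hj.1⟩
  have hm := Finset.min'_mem _ hn
  set j₀ := Finset.min' _ hn with hj₀
  simp only [Finset.mem_filter, Finset.mem_univ, true_and] at hm
  have hle : j₀ ≤ j := Finset.min'_le _ _ (by simpa using Fin.ext hj.1)
  refine ⟨j₀, hm, fun j' hj' h' => ?_, fun i' hi' h' => ?_⟩
  · exact absurd (Finset.min'_le (univ.filter fun j : Fin c => T i j = v) j' (by simpa using h'))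
      (not_le.2 hj')
  · have h1 := hj.2 i' hi'
    have h2 : (T i' j₀ : ℕ) ≤ T i' j := hT.1 i' _ _ hle
    have h3 : (T i' j : ℕ) < T i j := hT.2 i' i j (Fin.lt_def.2 (by omega))
    omega

theorem replLeftmost_apply_of_isLowerable (h : IsLowerable T i v j₀) (i' : Fin r) (j : Fin c) :
    (replLeftmost r c t T i v i' j : ℕ) = if i' = i ∧ j = j₀ then (v : ℕ) - 1 else T i' j := by
  unfold replLeftmost
  by_cases hij : i' = i ∧ j = j₀
  · obtain ⟨rfl, rfl⟩ := hij
    rw [if_pos ⟨rfl, h.eq, h.left⟩]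
    simp
  · rw [if_neg hij, if_neg]
    rintro ⟨rfl, h1, h2⟩
    rcases lt_trichotomy j j₀ with hlt | heq | hgt
    · exact h.left _ hlt h1
    · exact hij ⟨rfl, heq⟩
    · exact h2 _ hgt h.eq

theorem ssytCond_replLeftmost (hT : SSYTCond r c t T) (hv : Odd (v : ℕ))
    (h : IsLowerable T i v j₀) : SSYTCond r c t (replLeftmost r c t T i v) := by
  have hv0 := hv.pos
  have heq : (T i j₀ : ℕ) = v := congrArg Fin.val h.eq
  constructor
  · intro i' j j' hjj
    rw [Fin.le_def, replLeftmost_apply_of_isLowerable h, replLeftmost_apply_of_isLowerable h]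
    have h1 : (T i' j : ℕ) ≤ T i' j' := hT.1 i' j j' hjj
    split_ifs with h2 h3 h3
    · exact le_rfl
    · obtain ⟨rfl, rfl⟩ := h2
      omega
    · obtain ⟨rfl, rfl⟩ := h3
      have h4 := h.left j (lt_of_le_of_ne hjj fun h' => h2 ⟨rfl, h'⟩)
      have h5 : (T i' j : ℕ) ≠ v := fun h' => h4 (Fin.ext h')
      omega
    · exact h1
  · intro i₁ i₂ j hii
    rw [Fin.lt_def, replLeftmost_apply_of_isLowerable h, replLeftmost_apply_of_isLowerable h]
    have h1 : (T i₁ j : ℕ) < T i₂ j := hT.2 i₁ i₂ j hii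
    split_ifs with h2 h3 h3
    · exact absurd (h2.1.trans h3.1.symm) hii.ne
    · obtain ⟨rfl, rfl⟩ := h2
      omega
    · obtain ⟨rfl, rfl⟩ := h3
      by_cases h4 : (i₁ : ℕ) + 1 = i₂
      · have := h.above i₁ h4
        omega
      · have hlt : (i₁ : ℕ) < i₂ := hii
        let k : Fin r := ⟨i₁ + 1, by omega⟩
        have h5 : (T i₁ j : ℕ) < T k j := hT.2 _ _ j (Fin.lt_def.2 (by simp [k]))
        have h6 : (T k j : ℕ) < T i₂ j := hT.2 _ _ j (Fin.lt_def.2 (by simp [k]; omega))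
        omega
    · exact h1

theorem mem_lowerable_replLeftmost (hT : SSYTCond r c t T) (hv : Odd (v : ℕ))
    (hv' : Odd (v' : ℕ)) (h : IsLowerable T i v j₀) (i' : Fin r) (j : Fin c) :
    ((replLeftmost r c t T i v i' j : ℕ) = v' ∧
      NoAbove r c t (replLeftmost r c t T i v) i' j v') ↔
    ((T i' j : ℕ) = v' ∧ NoAbove r c t T i' j v') ∧ ¬ (i' = i ∧ v' = v ∧ j = j₀) := by
  obtain ⟨a, ha⟩ := hv
  obtain ⟨b, hb⟩ := hv'
  have heq : (T i j₀ : ℕ) = v := congrArg Fin.val h.eq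
  simp only [NoAbove, replLeftmost_apply_of_isLowerable h]
  by_cases hj : j = j₀
  swap
  · simp [hj]
  subst hj
  by_cases hi : i' = i
  · subst hi
    have : ∀ k : Fin r, (k : ℕ) + 1 = i' → k ≠ i' := fun k hk hki => by subst hki; omega
    simp only [and_true, true_and, if_true]
    constructor
    · rintro ⟨h1, -⟩
      omega
    · rintro ⟨⟨h1, -⟩, h2⟩
      exact absurd (Fin.ext (by omega)) h2
  · simp only [hi, and_true, false_and, if_false, not_false_eq_true]
    refine and_congr_right fun h1 => forall_congr' fun k => forall_congr' fun hk => ?_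
    by_cases hki : k = i
    · subst hki
      have h2 : (T k j : ℕ) < T i' j := hT.2 _ _ j (Fin.lt_def.2 (by omega))
      rw [if_pos rfl]
      omega
    · rw [if_neg hki]

theorem decCount_replLeftmost_self (hT : SSYTCond r c t T) (hv : Odd (v : ℕ))
    (h : IsLowerable T i v j₀) :
    decCount r c t (replLeftmost r c t T i v) i v + 1 = decCount r c t T i v := by
  have heq : (T i j₀ : ℕ) = v := congrArg Fin.val h.eq
  have hmem : j₀ ∈ univ.filter fun j : Fin c => (T i j : ℕ) = v ∧ NoAbove r c t T i j v := by
    simp only [Finset.mem_filter, Finset.mem_univ, true_and]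
    exact ⟨heq, h.above⟩
  unfold decCount
  rw [← Finset.card_erase_add_one hmem]
  congr 2
  ext j
  simp only [Finset.mem_filter, Finset.mem_univ, true_and, Finset.mem_erase,
    mem_lowerable_replLeftmost hT hv hv h]
  tauto

theorem decCount_replLeftmost_of_ne (hT : SSYTCond r c t T) (hv : Odd (v : ℕ))
    (hv' : Odd (v' : ℕ)) (h : IsLowerable T i v j₀) (hne : ¬ (i' = i ∧ v' = v)) :
    decCount r c t (replLeftmost r c t T i v) i' v' = decCount r c t T i' v' := by
  unfold decCount
  congr 1
  ext j
  simp only [Finset.mem_filter, Finset.mem_univ, true_and,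
    mem_lowerable_replLeftmost hT hv hv' h]
  tauto

theorem mem_raisable_replLeftmost_self (hT : SSYTCond r c t T) (hv : Odd (v : ℕ))
    (h : IsLowerable T i v j₀) : j₀ ∈ raisable (replLeftmost r c t T i v) i v := by
  have hv0 := hv.pos
  have heq : (T i j₀ : ℕ) = v := congrArg Fin.val h.eq
  simp only [raisable, Finset.mem_filter, Finset.mem_univ, true_and,
    replLeftmost_apply_of_isLowerable h, and_true, if_true]
  refine ⟨by omega, fun k hk => ?_⟩
  have h1 : (T i j₀ : ℕ) < T k j₀ := hT.2 _ _ j₀ (Fin.lt_def.2 (by omega))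
  rw [if_neg (fun h' => by subst h'; omega)]
  omega

theorem raisable_replLeftmost_of_ne (hv : Odd (v : ℕ)) (hv' : Odd (v' : ℕ))
    (h : IsLowerable T i v j₀) (hne : ¬ (i' = i ∧ v' = v)) :
    raisable (replLeftmost r c t T i v) i' v' = raisable T i' v' := by
  obtain ⟨a, ha⟩ := hv
  obtain ⟨b, hb⟩ := hv'
  have heq : (T i j₀ : ℕ) = v := congrArg Fin.val h.eq
  ext j
  simp only [raisable, Finset.mem_filter, Finset.mem_univ, true_and,
    replLeftmost_apply_of_isLowerable h]
  by_cases hj : j = j₀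
  swap
  · simp [hj]
  subst hj
  by_cases hi : i' = i
  · subst hi
    have hvv : (v' : ℕ) ≠ v := fun h' => hne ⟨rfl, Fin.ext h'⟩
    simp only [and_true, if_true]
    constructor <;> rintro ⟨h1, -⟩ <;> omega
  · simp only [hi, and_true, if_false]
    refine and_congr_right fun h1 => forall_congr' fun k => forall_congr' fun hk => ?_
    by_cases hki : k = i
    · subst hki
      have := h.above i' hk
      rw [if_pos rfl]
      omega
    · rw [if_neg hki]

theorem replLeftmost_comm (hv : Odd (v : ℕ)) (hv' : Odd (v' : ℕ)) (hne : ¬ (i' = i ∧ v' = v)) :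
    replLeftmost r c t (replLeftmost r c t T i v) i' v' =
      replLeftmost r c t (replLeftmost r c t T i' v') i v := by
  have key : ∀ (i i' : Fin r) (v v' : Fin (r + t)), Odd (v : ℕ) → Odd (v' : ℕ) →
      ¬ (i' = i ∧ v' = v) → ∀ j, replLeftmost r c t T i v i' j = v' ↔ T i' j = v' := by
    rintro i i' v v' ⟨a, ha⟩ ⟨b, hb⟩ hne j
    simp only [replLeftmost]
    split_ifs with h
    · obtain ⟨rfl, h1, -⟩ := h
      have hvv : (v' : ℕ) ≠ v := fun h' => hne ⟨rfl, Fin.ext h'⟩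
      have h2 : (T i' j : ℕ) = v := congrArg Fin.val h1
      simp only [Fin.ext_iff]
      omega
    · rfl
  have k1 := key i i' v v' hv hv' hne
  have k2 := key i' i v' v hv' hv (fun h => hne ⟨h.1.symm, h.2.symm⟩)
  have e1 : ∀ k j, replLeftmost r c t (replLeftmost r c t T i v) i' v' k j =
      if k = i' ∧ T i' j = v' ∧ ∀ j'' : Fin c, j'' < j → T i' j'' ≠ v' then
        ⟨(v' : ℕ) - 1, Nat.lt_of_le_of_lt (Nat.sub_le _ _) v'.2⟩
      else replLeftmost r c t T i v k j := fun k j => by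
    conv_lhs => unfold replLeftmost
    by_cases hk : k = i'
    · subst hk
      simp only [← k1, ne_eq]
      rfl
    · simp only [hk, false_and, if_false]
      rfl
  have e2 : ∀ k j, replLeftmost r c t (replLeftmost r c t T i' v') i v k j =
      if k = i ∧ T i j = v ∧ ∀ j'' : Fin c, j'' < j → T i j'' ≠ v then
        ⟨(v : ℕ) - 1, Nat.lt_of_le_of_lt (Nat.sub_le _ _) v.2⟩
      else replLeftmost r c t T i' v' k j := fun k j => by
    conv_lhs => unfold replLeftmost
    by_cases hk : k = i
    · subst hk
      simp only [← k2, ne_eq]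
      rfl
    · simp only [hk, false_and, if_false]
      rfl
  funext k j
  rw [e1, e2]
  unfold replLeftmost
  by_cases h1 : k = i' ∧ T i' j = v' ∧ ∀ j'' : Fin c, j'' < j → T i' j'' ≠ v'
  · obtain ⟨rfl, h1, h1'⟩ := h1
    have h2 : ¬ (k = i ∧ T i j = v ∧ ∀ j'' : Fin c, j'' < j → T i j'' ≠ v) := by
      rintro ⟨rfl, h2, -⟩
      exact hne ⟨rfl, h1.symm.trans h2⟩
    rw [if_pos ⟨rfl, h1, h1'⟩, if_neg h2, if_pos ⟨rfl, h1, h1'⟩]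
  · rw [if_neg h1]
    by_cases h2 : k = i ∧ T i j = v ∧ ∀ j'' : Fin c, j'' < j → T i j'' ≠ v
    · obtain ⟨rfl, h2⟩ := h2
      rw [if_pos ⟨rfl, h2⟩, if_pos ⟨rfl, h2⟩]
    · rw [if_neg h2, if_neg (by rintro ⟨rfl, h⟩; exact h2 ⟨rfl, h⟩),
        if_neg (by rintro ⟨rfl, h⟩; exact h1 ⟨rfl, h⟩)]

theorem replLeftmost_injective {T' : Fin r → Fin c → Fin (r + t)} {j₁ : Fin c}
    (hT : SSYTCond r c t T) (hT' : SSYTCond r c t T') (hv : Odd (v : ℕ))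
    (h : IsLowerable T i v j₀) (h' : IsLowerable T' i v j₁)
    (heq : replLeftmost r c t T i v = replLeftmost r c t T' i v) : T = T' := by
  have hv0 := hv.pos
  have key : ∀ {T T' : Fin r → Fin c → Fin (r + t)} {j₀ j₁ : Fin c}, SSYTCond r c t T →
      IsLowerable T i v j₀ → IsLowerable T' i v j₁ →
      replLeftmost r c t T i v = replLeftmost r c t T' i v → ¬ j₀ < j₁ := by
    intro T T' j₀ j₁ hT h h' heq hlt
    have h1 := congrArg Fin.val (congrFun (congrFun heq i) j₁)
    rw [replLeftmost_apply_of_isLowerable h, replLeftmost_apply_of_isLowerable h',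
      if_neg (fun h2 => hlt.ne' h2.2), if_pos ⟨rfl, rfl⟩] at h1
    have h2 : (T i j₀ : ℕ) ≤ T i j₁ := hT.1 i _ _ hlt.le
    have h3 : (T i j₀ : ℕ) = v := congrArg Fin.val h.eq
    omega
  obtain rfl : j₀ = j₁ :=
    le_antisymm (not_lt.1 (key hT' h' h heq.symm)) (not_lt.1 (key hT h h' heq))
  funext k j
  have h1 := congrArg Fin.val (congrFun (congrFun heq k) j)
  rw [replLeftmost_apply_of_isLowerable h, replLeftmost_apply_of_isLowerable h'] at h1
  split_ifs at h1 with h2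
  · obtain ⟨rfl, rfl⟩ := h2
    exact h.eq.trans h'.eq.symm
  · exact Fin.ext h1

theorem exists_replLeftmost_eq (hT : SSYTCond r c t T) (h : (raisable T i v).Nonempty) :
    ∃ T' j₀, SSYTCond r c t T' ∧ IsLowerable T' i v j₀ ∧ replLeftmost r c t T' i v = T := by
  have hm := Finset.max'_mem _ h
  set j₁ := Finset.max' _ h with hj₁
  have hmax : ∀ j ∈ raisable T i v, j ≤ j₁ := fun j hj => Finset.le_max' _ j hj
  simp only [raisable, Finset.mem_filter, Finset.mem_univ, true_and] at hm hmax
  obtain ⟨hm, hbelow⟩ := hm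
  let T' : Fin r → Fin c → Fin (r + t) := fun k j => if k = i ∧ j = j₁ then v else T k j
  have hT'v : T' i j₁ = v := if_pos ⟨rfl, rfl⟩
  have hT'ne : ∀ k j, ¬ (k = i ∧ j = j₁) → T' k j = T k j := fun k j h => if_neg h
  have hlow : IsLowerable T' i v j₁ := by
    refine ⟨hT'v, fun j hj h' => ?_, fun k hk h' => ?_⟩
    · rw [hT'ne _ _ fun h => hj.ne h.2] at h'
      have h1 : (T i j : ℕ) ≤ T i j₁ := hT.1 _ _ _ hj.le
      rw [h'] at h1
      omega
    · have h2 : (T k j₁ : ℕ) < T i j₁ := hT.2 _ _ _ (Fin.lt_def.2 (by omega))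
      rw [hT'ne _ _ fun h => by rw [h.1] at hk; omega] at h'
      omega
  refine ⟨T', j₁, ⟨fun k j j' hjj => ?_, fun k k' j hkk => ?_⟩, hlow, ?_⟩
  · have h1 : (T k j : ℕ) ≤ T k j' := hT.1 _ _ _ hjj
    simp only [T', Fin.le_def]
    split_ifs with h2 h3 h3
    · exact le_rfl
    · obtain ⟨rfl, rfl⟩ := h2
      by_contra hlt
      have hj : ¬ j' ≤ j₁ := fun h' => h3 ⟨rfl, le_antisymm h' hjj⟩
      refine hj (hmax j' ⟨by omega, fun l hl h4 => hbelow l hl ?_⟩)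
      have h5 : (T l j₁ : ℕ) ≤ T l j' := hT.1 _ _ _ hjj
      have h6 : (T k j₁ : ℕ) < T l j₁ := hT.2 _ _ _ (Fin.lt_def.2 (by omega))
      omega
    · obtain ⟨rfl, rfl⟩ := h3
      omega
    · exact h1
  · have h1 : (T k j : ℕ) < T k' j := hT.2 _ _ _ hkk
    simp only [T', Fin.lt_def]
    split_ifs with h2 h3 h3
    · exact absurd (h2.1.trans h3.1.symm) hkk.ne
    · obtain ⟨rfl, rfl⟩ := h2
      by_cases h4 : (k : ℕ) + 1 = k'
      · have := hbelow k' h4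
        omega
      · have hlt : (k : ℕ) < k' := hkk
        let l : Fin r := ⟨k + 1, by omega⟩
        have h5 : (T k j₁ : ℕ) < T l j₁ := hT.2 _ _ _ (Fin.lt_def.2 (by simp [l]))
        have h6 : (T l j₁ : ℕ) < T k' j₁ := hT.2 _ _ _ (Fin.lt_def.2 (by simp [l]; omega))
        omega
    · obtain ⟨rfl, rfl⟩ := h3
      omega
    · exact h1
  · funext k j
    apply Fin.ext
    rw [replLeftmost_apply_of_isLowerable hlow]
    split_ifs with h2
    · obtain ⟨rfl, rfl⟩ := h2
      omega
    · rw [hT'ne _ _ h2]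

theorem sum_replLeftmost (hv : Odd (v : ℕ)) (h : IsLowerable T i v j₀) :
    ∑ k, ∑ j, (replLeftmost r c t T i v k j : ℕ) + 1 = ∑ k, ∑ j, (T k j : ℕ) := by
  have hv0 := hv.pos
  have heq : (T i j₀ : ℕ) = v := congrArg Fin.val h.eq
  simp only [replLeftmost_apply_of_isLowerable h, ← Fintype.sum_prod_type'
    (f := fun (k : Fin r) (j : Fin c) => if k = i ∧ j = j₀ then (v : ℕ) - 1 else (T k j : ℕ)),
    ← Fintype.sum_prod_type' (f := fun (k : Fin r) (j : Fin c) => (T k j : ℕ))]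
  rw [← Finset.add_sum_erase _ _ (Finset.mem_univ (i, j₀)),
    ← Finset.add_sum_erase (f := fun x : Fin r × Fin c => (T x.1 x.2 : ℕ)) _
      (Finset.mem_univ (i, j₀))]
  have : ∑ x ∈ univ.erase (i, j₀), (if x.1 = i ∧ x.2 = j₀ then (v : ℕ) - 1 else (T x.1 x.2 : ℕ)) =
      ∑ x ∈ univ.erase (i, j₀), (T x.1 x.2 : ℕ) := by
    refine Finset.sum_congr rfl fun x hx => if_neg fun h' => ?_
    exact (Finset.mem_erase.1 hx).1 (Prod.ext h'.1 h'.2)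
  rw [this]
  simp only [and_self, if_true]
  omega

/-- The number of odd entries in row `i`. -/
def oddCount (T : Fin r → Fin c → Fin (r + t)) (i : Fin r) : ℕ :=
  (univ.filter fun j : Fin c => Odd (T i j : ℕ)).card

theorem oddCount_modEq (hdec : ∀ v : Fin (r + t), Odd (v : ℕ) → Even (decCount r c t T i v)) :
    oddCount T i ≡ (univ.filter fun j : Fin c =>
      Odd (T i j : ℕ) ∧ ¬ NoAbove r c t T i j (T i j)).card [MOD 2] := by
  have h1 : (univ.filter fun j : Fin c => Odd (T i j : ℕ) ∧ NoAbove r c t T i j (T i j)).card =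
      ∑ v : Fin (r + t), if Odd (v : ℕ) then decCount r c t T i v else 0 := by
    rw [Finset.card_eq_sum_card_fiberwise (f := fun j => T i j) (t := univ) (by simp)]
    refine Finset.sum_congr rfl fun v _ => ?_
    split_ifs with hv
    · unfold decCount
      congr 1
      ext j
      simp only [Finset.mem_filter, Finset.mem_univ, true_and]
      constructor
      · rintro ⟨⟨-, h⟩, rfl⟩
        exact ⟨rfl, h⟩
      · rintro ⟨h1, h2⟩
        obtain rfl : T i j = v := Fin.ext h1
        exact ⟨⟨hv, h2⟩, rfl⟩
    · rw [Finset.card_eq_zero, Finset.filter_eq_empty_iff]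
      rintro j hj rfl
      exact hv (Finset.mem_filter.1 hj).2.1
  have h2 : Even (∑ v : Fin (r + t), if Odd (v : ℕ) then decCount r c t T i v else 0) := by
    refine Finset.even_sum _ fun v _ => ?_
    split_ifs with hv
    · exact hdec v hv
    · exact Even.zero
  have h3 := Finset.card_filter_add_card_filter_not
    (s := univ.filter fun j : Fin c => Odd (T i j : ℕ)) fun j => NoAbove r c t T i j (T i j)
  rw [Finset.filter_filter, Finset.filter_filter, h1] at h3
  unfold oddCount
  rw [← h3]
  obtain ⟨a, ha⟩ := h2
  rw [ha]
  unfold Nat.ModEq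
  omega

theorem oddCount_modEq_mul (hT : SSYTCond r c t T)
    (hdec : ∀ (i : Fin r) (v : Fin (r + t)), Odd (v : ℕ) → Even (decCount r c t T i v))
    (hraise : ∀ (i : Fin r) (v : Fin (r + t)), Odd (v : ℕ) → ¬ (raisable T i v).Nonempty) :
    ∀ (n : ℕ) (hn : n < r), oddCount T ⟨n, hn⟩ ≡ n * c [MOD 2] := by
  intro n
  induction n with
  | zero =>
    intro hn
    refine (oddCount_modEq (hdec _)).trans ?_
    rw [Finset.card_eq_zero.2, zero_mul]
    rw [Finset.filter_eq_empty_iff]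
    rintro j - ⟨-, h⟩
    exact h fun k hk => by simp at hk
  | succ n ih =>
    intro hn
    have ihn := ih (by omega)
    refine (oddCount_modEq (hdec _)).trans ?_
    set i₀ : Fin r := ⟨n, by omega⟩ with hi₀
    set i₁ : Fin r := ⟨n + 1, hn⟩ with hi₁
    have h1 : (univ.filter fun j : Fin c => Odd (T i₁ j : ℕ) ∧
        ¬ NoAbove r c t T i₁ j (T i₁ j)) = univ.filter fun j : Fin c => ¬ Odd (T i₀ j : ℕ) := by
      refine Finset.filter_congr fun j _ => ?_
      have hlt : (T i₀ j : ℕ) < T i₁ j := hT.2 _ _ _ (Fin.lt_def.2 (by simp [hi₀, hi₁]))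
      constructor
      · rintro ⟨⟨a, ha⟩, h⟩ ⟨b, hb⟩
        refine h fun k hk => ?_
        obtain rfl : k = i₀ := Fin.ext (by simpa [hi₀, hi₁] using hk)
        omega
      · intro h
        have hodd : Odd ((T i₀ j : ℕ) + 1) := by
          rw [Nat.odd_add_one]
          exact h
        have hb : (T i₁ j : ℕ) = T i₀ j + 1 := by
          by_contra hne
          refine hraise i₀ ⟨(T i₀ j : ℕ) + 1, by omega⟩ hodd ⟨j, ?_⟩
          simp only [raisable, Finset.mem_filter, Finset.mem_univ, true_and]
          intro k hk
          obtain rfl : k = i₁ := Fin.ext (by simpa [hi₀, hi₁] using hk.symm)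
          exact hne
        refine ⟨hb ▸ hodd, fun h' => h' i₀ (by simp [hi₀, hi₁]) (by omega)⟩
    have h2 := Finset.card_filter_add_card_filter_not
      (s := (univ : Finset (Fin c))) fun j => Odd (T i₀ j : ℕ)
    rw [h1]
    rw [Finset.card_univ, Fintype.card_fin] at h2
    have h3 : oddCount T i₀ = (univ.filter fun j : Fin c => Odd (T i₀ j : ℕ)).card := rfl
    rw [← h3] at h2
    have h4 : (n + 1) * c = n * c + c := by ring
    unfold Nat.ModEq at ihn ⊢
    rw [h4]
    omega

theorem sum_modEq_of_critical (hT : SSYTCond r c t T)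
    (hdec : ∀ (i : Fin r) (v : Fin (r + t)), Odd (v : ℕ) → Even (decCount r c t T i v))
    (hraise : ∀ (i : Fin r) (v : Fin (r + t)), Odd (v : ℕ) → ¬ (raisable T i v).Nonempty) :
    ∑ i, ∑ j, (T i j : ℕ) ≡ c * r.choose 2 [MOD 2] := by
  have h1 : ∀ i, ∑ j, (T i j : ℕ) ≡ i * c [MOD 2] := fun i => by
    refine Nat.ModEq.trans ?_ (oddCount_modEq_mul hT hdec hraise i i.2)
    have := Finset.odd_sum_iff_odd_card_odd (s := univ) fun j => (T i j : ℕ)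
    simp only [Nat.odd_iff] at this
    simp only [oddCount, Nat.odd_iff, Nat.ModEq, Fin.eta]
    omega
  have h2 : ∑ i : Fin r, (i : ℕ) * c = c * r.choose 2 := by
    rw [← Finset.sum_mul, Fin.sum_univ_eq_sum_range (fun n => n), Finset.sum_range_id,
      Nat.choose_two_right, mul_comm]
  rw [← h2]
  exact Nat.ModEq.sum fun i _ => h1 i

end Tableaux

/-- The matching in direction `(i, v)`, extended by the identity. -/
def lowerSSYT (r c t : ℕ) (s : Fin r × Fin (r + t)) (T : SSYT r c t) : SSYT r c t :=
  if h : SSYTCond r c t (replLeftmost r c t T.1 s.1 s.2) then ⟨_, h⟩ else T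

theorem lowerSSYT_val {r c t : ℕ} {s : Fin r × Fin (r + t)} {T : SSYT r c t} {j₀ : Fin c}
    (hv : Odd (s.2 : ℕ)) (h : IsLowerable T.1 s.1 s.2 j₀) :
    (lowerSSYT r c t s T).1 = replLeftmost r c t T.1 s.1 s.2 := by
  rw [lowerSSYT, dif_pos (ssytCond_replLeftmost T.2 hv h)]

theorem normSSYT_lowerSSYT {r c t : ℕ} {s : Fin r × Fin (r + t)} {T : SSYT r c t} {j₀ : Fin c}
    (hv : Odd (s.2 : ℕ)) (h : IsLowerable T.1 s.1 s.2 j₀) :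
    normSSYT r c t (lowerSSYT r c t s T) + 1 = normSSYT r c t T := by
  unfold normSSYT
  rw [lowerSSYT_val hv h]
  exact sum_replLeftmost hv h

theorem dSSYT_single {r c t : ℕ} (T : SSYT r c t) :
    dSSYT r c t (Finsupp.single T 1) = ∑ s : Fin r × Fin (r + t),
      if Odd (s.2 : ℕ) ∧ Odd (decCount r c t T.1 s.1 s.2) then
        Finsupp.single (lowerSSYT r c t s T) (1 : ZMod 2) else 0 := by
  rw [Fintype.sum_prod_type]
  simp only [dSSYT, Finsupp.lift_apply, zero_smul, Finsupp.sum_single_index, one_smul]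
  refine Finset.sum_congr rfl fun i _ => Finset.sum_congr rfl fun v _ => ?_
  by_cases h : Odd (v : ℕ) ∧ Odd (decCount r c t T.1 i v)
  · obtain ⟨j₀, hj₀⟩ := exists_isLowerable T.2 h.2
    have hc := ssytCond_replLeftmost T.2 h.1 hj₀
    rw [if_pos h, dif_pos ⟨h.1, h.2, hc⟩, lowerSSYT, dif_pos hc]
  · rw [if_neg h, dif_neg fun h' => h ⟨h'.1, h'.2.1⟩]

theorem exists_homotopy_dSSYT (r c t : ℕ) :
    ∃ H : (SSYT r c t →₀ ZMod 2) →ₗ[ZMod 2] (SSYT r c t →₀ ZMod 2), ∀ T : SSYT r c t,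
      ¬ normSSYT r c t T ≡ c * r.choose 2 [MOD 2] →
      dSSYT r c t (H (Finsupp.single T 1)) + H (dSSYT r c t (Finsupp.single T 1)) =
        Finsupp.single T 1 ∧
      (H (Finsupp.single T 1) = 0 ∨ ∃ T', normSSYT r c t T' = normSSYT r c t T + 1 ∧
        H (Finsupp.single T 1) = Finsupp.single T' 1) := by
  refine (exists_homotopy_of_commuting_matchings (lowerSSYT r c t)
    (fun s T => Odd (s.2 : ℕ) ∧ Odd (decCount r c t T.1 s.1 s.2))
    (fun s T => Odd (s.2 : ℕ) ∧ Even (decCount r c t T.1 s.1 s.2) ∧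
      (raisable T.1 s.1 s.2).Nonempty)
    (dSSYT r c t) dSSYT_single ?_ ?_ ?_ ?_ ?_ ?_ ?_).imp fun H hH T hT => ?_
  · rintro s T T' ⟨hv, ho⟩ ⟨-, ho'⟩ heq
    obtain ⟨j₀, hj₀⟩ := exists_isLowerable T.2 ho
    obtain ⟨j₁, hj₁⟩ := exists_isLowerable T'.2 ho'
    have := congrArg Subtype.val heq
    rw [lowerSSYT_val hv hj₀, lowerSSYT_val hv hj₁] at this
    exact Subtype.ext (replLeftmost_injective T.2 T'.2 hv hj₀ hj₁ this)
  · rintro s T ⟨hv, ho⟩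
    obtain ⟨j₀, hj₀⟩ := exists_isLowerable T.2 ho
    rw [lowerSSYT_val hv hj₀]
    refine ⟨hv, ?_, j₀, mem_raisable_replLeftmost_self T.2 hv hj₀⟩
    rw [← decCount_replLeftmost_self T.2 hv hj₀, Nat.odd_add_one] at ho
    exact Nat.not_odd_iff_even.1 ho
  · rintro s T ⟨hv, he, hn⟩
    obtain ⟨T', j₀, hT', hj₀, heq⟩ := exists_replLeftmost_eq T.2 hn
    refine ⟨⟨T', hT'⟩, ⟨hv, ?_⟩, Subtype.ext ?_⟩
    · rw [← decCount_replLeftmost_self hT' hv hj₀, heq]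
      exact he.add_one
    · rw [lowerSSYT_val hv hj₀]
      exact heq
  · rintro s T ⟨-, he, -⟩ ⟨-, ho⟩
    exact Nat.not_odd_iff_even.2 he ho
  · rintro s s' T hne ⟨hv', ho'⟩
    obtain ⟨j₀, hj₀⟩ := exists_isLowerable T.2 ho'
    refine and_congr_right fun hv => ?_
    rw [lowerSSYT_val hv' hj₀,
      decCount_replLeftmost_of_ne T.2 hv' hv hj₀ fun h => hne (Prod.ext h.1 h.2)]
  · rintro s s' T hne ⟨hv', ho'⟩
    obtain ⟨j₀, hj₀⟩ := exists_isLowerable T.2 ho'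
    refine and_congr_right fun hv => ?_
    rw [lowerSSYT_val hv' hj₀,
      decCount_replLeftmost_of_ne T.2 hv' hv hj₀ fun h => hne (Prod.ext h.1 h.2),
      raisable_replLeftmost_of_ne hv' hv hj₀ fun h => hne (Prod.ext h.1 h.2)]
  · rintro s s' T hne ⟨hv, ho⟩ ⟨hv', ho'⟩
    have hcomm : ∀ s s' : Fin r × Fin (r + t), s ≠ s' → Odd (s.2 : ℕ) → Odd (s'.2 : ℕ) →
        Odd (decCount r c t T.1 s.1 s.2) → Odd (decCount r c t T.1 s'.1 s'.2) →
        (lowerSSYT r c t s (lowerSSYT r c t s' T)).1 =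
          replLeftmost r c t (replLeftmost r c t T.1 s'.1 s'.2) s.1 s.2 := by
      intro s s' hne hv hv' ho ho'
      obtain ⟨j₀, hj₀⟩ := exists_isLowerable T.2 ho'
      have h1 := lowerSSYT_val hv' hj₀
      rw [← decCount_replLeftmost_of_ne T.2 hv' hv hj₀ fun h => hne (Prod.ext h.1 h.2),
        ← h1] at ho
      obtain ⟨j₁, hj₁⟩ := exists_isLowerable (lowerSSYT r c t s' T).2 ho
      rw [lowerSSYT_val hv hj₁, h1]
    apply Subtype.ext
    rw [hcomm s s' hne hv hv' ho ho', hcomm s' s hne.symm hv' hv ho' ho]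
    exact replLeftmost_comm hv' hv fun h => hne (Prod.ext h.1 h.2)
  · obtain ⟨h1, h2⟩ := hH T (by
      by_contra! hcon
      refine hT (sum_modEq_of_critical T.2 (fun i v hv => ?_) fun i v hv hn => ?_)
      · exact Nat.not_odd_iff_even.1 ((hcon (i, v)).1 hv)
      · have he := Nat.not_odd_iff_even.1 ((hcon (i, v)).1 hv)
        exact hn.ne_empty ((hcon (i, v)).2 hv he))
    refine ⟨h1, h2.imp_right ?_⟩
    rintro ⟨s, T', ⟨hv, ho⟩, rfl, hHT⟩
    obtain ⟨j₀, hj₀⟩ := exists_isLowerable T'.2 ho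
    exact ⟨T', (normSSYT_lowerSSYT hv hj₀).symm, hHT⟩

/-- (Theorem 5.7.) The homology of `(C(r,c,t), d)` is concentrated in even ranks, where
`rank(T) = ‖T‖ − c·C(r,2)`: every cycle supported in an odd rank `m` is the boundary of a
chain supported in rank `m + 1`. -/
theorem ssyt_homology_concentrated_in_even_ranks (r c t : ℕ)
    (hr : 0 < r) (hc : 0 < c) (ht : 0 < t) :
    ∀ m : ℕ, Odd m →
      ∀ u ∈ Submodule.span (ZMod 2)
          {f : SSYT r c t →₀ ZMod 2 | ∃ T : SSYT r c t,
            normSSYT r c t T - c * Nat.choose r 2 = m ∧ f = Finsupp.single T (1 : ZMod 2)},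
        dSSYT r c t u = 0 →
          ∃ w ∈ Submodule.span (ZMod 2)
              {f : SSYT r c t →₀ ZMod 2 | ∃ T : SSYT r c t,
                normSSYT r c t T - c * Nat.choose r 2 = m + 1 ∧
                  f = Finsupp.single T (1 : ZMod 2)},
            dSSYT r c t w = u := by
  intro m hm u hu hdu
  obtain ⟨H, hH⟩ := exists_homotopy_dSSYT r c t
  have key : H u ∈ Submodule.span (ZMod 2)
      {f : SSYT r c t →₀ ZMod 2 | ∃ T : SSYT r c t,
        normSSYT r c t T - c * Nat.choose r 2 = m + 1 ∧ f = Finsupp.single T (1 : ZMod 2)} ∧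
      dSSYT r c t (H u) + H (dSSYT r c t u) = u := by
    clear hdu
    induction hu using Submodule.span_induction with
    | mem x hx =>
      obtain ⟨T, hT, rfl⟩ := hx
      obtain ⟨a, ha⟩ := hm
      obtain ⟨h1, h2⟩ := hH T (by unfold Nat.ModEq; omega)
      refine ⟨?_, h1⟩
      rcases h2 with h2 | ⟨T', h3, h2⟩
      · rw [h2]
        exact Submodule.zero_mem _
      · rw [h2]
        exact Submodule.subset_span ⟨T', by omega, rfl⟩
    | zero => simp
    | add x y _ _ hx hy =>
      refine ⟨by rw [map_add]; exact Submodule.add_mem _ hx.1 hy.1, ?_⟩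
      simp only [map_add]
      rw [add_add_add_comm, hx.2, hy.2]
    | smul a x _ hx =>
      refine ⟨by rw [map_smul]; exact Submodule.smul_mem _ a hx.1, ?_⟩
      simp only [map_smul]
      rw [← smul_add, hx.2]
  refine ⟨H u, key.1, ?_⟩
  simpa [hdu] using key.2
end

section
/- Let r, c, t be positive integers. Then in the polynomial ring ℤ[q], ∑_{T ∈ SSYT(r,c,t)} q^{‖T‖} = ∑_{T ∈ Bottom(r,c,t)} q^{‖T‖} · (1+q)^{|E(T)|}. (Equivalently, the principally specialized Schur function s_{(c^r)}(1, q, …, q^{r+t−1}) has this expansion.) -/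
open scoped Classical

/-- `Bottom(r,c,t)`: tableaux in which no odd value can be decremented, i.e. for every row `i`
and every odd value `v` the number of copies of `v` in row `i` with no `v − 1` directly above
is even. -/
def IsBottom (r c t : ℕ) (T : SSYT r c t) : Prop :=
  ∀ (i : Fin r) (v : ℕ), Odd v → Even (decCount r c t T.1 i v)

/-- `E(T)`: the set of pairs `(i, v)` with `v` even, `v < r+t−1`, `v` occurring in row `i`,
whose rightmost occurrence in row `i` (in column `j`, say) satisfies `i = r−1` or
`T(i+1,j) ≠ v+1`, and such that the number of columns `j'` with `T(i,j') = v+1` and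
(`i = 0` or `T(i−1,j') ≠ v`) is even.  These are the admissible incrementations. -/
noncomputable def ESet (r c t : ℕ) (T : SSYT r c t) : Finset (Fin r × Fin (r + t)) :=
  Finset.univ.filter fun p : Fin r × Fin (r + t) =>
    Even (p.2 : ℕ) ∧ (p.2 : ℕ) < r + t - 1 ∧
      ∃ j : Fin c, T.1 p.1 j = p.2 ∧ (∀ j' : Fin c, j < j' → T.1 p.1 j' ≠ p.2) ∧
        (∀ i' : Fin r, (i' : ℕ) = (p.1 : ℕ) + 1 → (T.1 i' j : ℕ) ≠ (p.2 : ℕ) + 1) ∧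
        Even (decCount r c t T.1 p.1 ((p.2 : ℕ) + 1))

open Polynomial in
/-- Suppose the elements of `α` carry disjoint sets `D a` of admissible decrementations and `E a`
of admissible incrementations, and that for each index `p` the relation `R p` matches the elements
with `p ∈ D` bijectively with those with `p ∈ E`, lowering the rank `n` by one and affecting no
other index. Then the rank generating function of `α` expands over the elements with `D` empty. -/
theorem sum_X_pow_eq_sum_bottom {α ι : Type*} [Fintype α] [Fintype ι]
    (D E : α → Finset ι) (n : α → ℕ) (R : ι → α → α → Prop)
    (exists_down : ∀ p a, p ∈ D a → ∃ b, R p a b)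
    (exists_up : ∀ p b, p ∈ E b → ∃ a, R p a b)
    (down_unique : ∀ p a b b', R p a b → R p a b' → b = b')
    (up_unique : ∀ p a a' b, R p a b → R p a' b → a = a')
    (mem_iff : ∀ p a b, R p a b → (p ∈ D a ↔ p ∈ E b))
    (rank_eq : ∀ p a b, R p a b → n a = n b + 1)
    (D_iff : ∀ p a b, R p a b → ∀ q, q ≠ p → (q ∈ D a ↔ q ∈ D b))
    (E_iff : ∀ p a b, R p a b → ∀ q, q ≠ p → (q ∈ E a ↔ q ∈ E b))
    (disj : ∀ p a, p ∈ E a → p ∉ D a) :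
    (∑ a, (X : ℤ[X]) ^ n a) =
      ∑ a ∈ Finset.univ.filter (fun a => D a = ∅), (X : ℤ[X]) ^ n a * (1 + X) ^ (E a).card := by
  have key : ∀ S : Finset ι, (∑ a, (X : ℤ[X]) ^ n a) =
      ∑ a ∈ Finset.univ.filter (fun a => ∀ q ∈ S, q ∉ D a),
        (X : ℤ[X]) ^ n a * (1 + X) ^ (S.filter (· ∈ E a)).card := by
    intro S
    induction S using Finset.induction_on with
    | empty => simp
    | insert p S hp ih =>
      rw [ih, ← Finset.sum_filter_add_sum_filter_not _ (fun a => p ∈ D a)]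
      have h1 : ∑ a ∈ (Finset.univ.filter (fun a => ∀ q ∈ S, q ∉ D a)).filter (p ∈ D ·),
            (X : ℤ[X]) ^ n a * (1 + X) ^ (S.filter (· ∈ E a)).card =
          ∑ a ∈ (Finset.univ.filter (fun a => ∀ q ∈ insert p S, q ∉ D a)).filter (p ∈ E ·),
            X * ((X : ℤ[X]) ^ n a * (1 + X) ^ (S.filter (· ∈ E a)).card) := by
        choose f hf using exists_down p
        refine Finset.sum_bij (fun a ha => f a (Finset.mem_filter.1 ha).2) ?_ ?_ ?_ ?_
        · intro a ha
          have hR := hf a (Finset.mem_filter.1 ha).2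
          simp only [Finset.mem_filter, Finset.mem_univ, true_and, Finset.mem_insert,
            forall_eq_or_imp] at ha ⊢
          have hE := (mem_iff _ _ _ hR).1 ha.2
          exact ⟨⟨disj _ _ hE, fun q hq =>
            (D_iff _ _ _ hR q (fun h => hp (h ▸ hq))).not.1 (ha.1 q hq)⟩, hE⟩
        · intro a ha a' ha' h
          exact up_unique p _ _ _ (hf a (Finset.mem_filter.1 ha).2)
            (h ▸ hf a' (Finset.mem_filter.1 ha').2)
        · intro b hb
          simp only [Finset.mem_filter, Finset.mem_univ, true_and, Finset.mem_insert,
            forall_eq_or_imp] at hb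
          obtain ⟨a, hR⟩ := exists_up p b hb.2
          have hD := (mem_iff _ _ _ hR).2 hb.2
          refine ⟨a, ?_, down_unique p _ _ _ (hf a hD) hR⟩
          simp only [Finset.mem_filter, Finset.mem_univ, true_and]
          exact ⟨fun q hq =>
            (D_iff _ _ _ hR q (fun h => hp (h ▸ hq))).not.2 (hb.1.2 q hq), hD⟩
        · intro a ha
          have hR := hf a (Finset.mem_filter.1 ha).2
          have hS : S.filter (· ∈ E a) = S.filter (· ∈ E (f a (Finset.mem_filter.1 ha).2)) :=
            Finset.filter_congr fun q hq => E_iff _ _ _ hR q (fun h => hp (h ▸ hq))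
          rw [hS, rank_eq _ _ _ hR]
          ring
      have h2 : (Finset.univ.filter (fun a => ∀ q ∈ S, q ∉ D a)).filter (¬ p ∈ D ·) =
          Finset.univ.filter (fun a => ∀ q ∈ insert p S, q ∉ D a) := by
        ext a
        simp [and_comm]
      rw [h1, h2, Finset.sum_filter, ← Finset.sum_add_distrib]
      refine Finset.sum_congr rfl fun a _ => ?_
      rw [Finset.filter_insert]
      split_ifs with h
      · rw [Finset.card_insert_of_notMem (fun h' => hp (Finset.mem_filter.1 h').1)]
        ring
      · ring
  rw [key Finset.univ]
  refine Finset.sum_congr ?_ fun a _ => by simp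
  ext a
  simp [Finset.eq_empty_iff_forall_notMem]

/-- `T'` arises from `T` by decrementing an entry `v + 1` of row `i` to `v`, where `v` is even. -/
def DecStep (r c t : ℕ) (p : Fin r × Fin (r + t)) (T T' : SSYT r c t) : Prop :=
  Even (p.2 : ℕ) ∧ ∃ j : Fin c, (T.1 p.1 j : ℕ) = p.2 + 1 ∧ (T'.1 p.1 j : ℕ) = p.2 ∧
    ∀ i k, (i ≠ p.1 ∨ k ≠ j) → T.1 i k = T'.1 i k

/-- The pairs `(i, v)` with `v` even such that `v + 1` can be decremented in row `i`. -/
noncomputable def DSet (r c t : ℕ) (T : SSYT r c t) : Finset (Fin r × Fin (r + t)) :=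
  Finset.univ.filter fun p => Even (p.2 : ℕ) ∧ Odd (decCount r c t T.1 p.1 ((p.2 : ℕ) + 1))

section

variable {r c t : ℕ} {T T' : SSYT r c t} {p q : Fin r × Fin (r + t)}

theorem SSYT.row_le (T : SSYT r c t) (i : Fin r) {j k : Fin c} (h : j ≤ k) :
    (T.1 i j : ℕ) ≤ T.1 i k :=
  T.2.1 i j k h

theorem SSYT.col_lt (T : SSYT r c t) {i i' : Fin r} (j : Fin c) (h : (i : ℕ) < i') :
    (T.1 i j : ℕ) < T.1 i' j :=
  T.2.2 i i' j h

theorem DecStep.decCount_eq_of_ne (h : DecStep r c t p T T') (hq : Even (q.2 : ℕ)) (hqp : q ≠ p) :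
    decCount r c t T.1 q.1 ((q.2 : ℕ) + 1) = decCount r c t T'.1 q.1 ((q.2 : ℕ) + 1) := by
  obtain ⟨hp, j, h1, h2, h3⟩ := h
  obtain ⟨i, v⟩ := p
  obtain ⟨i', v'⟩ := q
  simp only at hp h1 h2 h3 hq ⊢
  unfold decCount NoAbove
  congr 1
  refine Finset.filter_congr fun k _ => ?_
  by_cases hk : k = j
  swap
  · simp only [h3 _ k (Or.inr hk)]
  subst hk
  by_cases hi : i' = i
  · subst hi
    have hv : (v' : ℕ) ≠ v := fun hv => hqp (by rw [Fin.ext hv])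
    rw [h1, h2]
    constructor <;> rintro ⟨ha, -⟩ <;> grind
  · rw [h3 i' k (Or.inl hi)]
    refine and_congr_right fun ha => forall_congr' fun i'' => imp_congr_right fun hi'' => ?_
    by_cases hi2 : i'' = i
    · subst hi2
      have := T.col_lt (i := i'') (i' := i') k (by omega)
      rw [h3 i' k (Or.inl hi)] at this
      rw [h1, h2]
      grind
    · rw [h3 _ k (Or.inl hi2)]

theorem DecStep.decCount_self (h : DecStep r c t p T T') :
    decCount r c t T.1 p.1 ((p.2 : ℕ) + 1) = decCount r c t T'.1 p.1 ((p.2 : ℕ) + 1) + 1 := by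
  obtain ⟨hp, j, h1, h2, h3⟩ := h
  obtain ⟨i, v⟩ := p
  simp only at hp h1 h2 h3 ⊢
  unfold decCount NoAbove
  rw [← Finset.card_insert_of_notMem (a := j) (by simp [h2])]
  congr 1
  ext k
  simp only [Finset.mem_filter, Finset.mem_univ, true_and, Finset.mem_insert, Nat.add_sub_cancel]
  by_cases hk : k = j
  · subst hk
    simp only [h1, true_or, iff_true, true_and]
    intro i' hi' h
    have := T'.col_lt (i := i') (i' := i) k (by omega)
    rw [← h3 i' k (Or.inl (by rintro rfl; omega))] at this
    omega
  · simp only [h3 _ k (Or.inr hk), hk, false_or]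

theorem DecStep.mem_DSet_iff_mem_ESet (h : DecStep r c t p T T') :
    p ∈ DSet r c t T ↔ p ∈ ESet r c t T' := by
  have hd := h.decCount_self
  obtain ⟨hp, j, h1, h2, h3⟩ := h
  simp only [DSet, ESet, Finset.mem_filter, Finset.mem_univ, true_and]
  rw [hd, Nat.odd_add_one, Nat.not_odd_iff_even]
  have hlt : (p.2 : ℕ) < r + t - 1 := by
    have := (T.1 p.1 j).2
    omega
  refine and_congr_right fun _ => ⟨fun he => ⟨hlt, j, Fin.ext h2, fun k hk hk' => ?_,
    fun i hi hij => ?_, he⟩, fun ⟨_, _, _, _, _, he⟩ => he⟩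
  · have := T.row_le p.1 hk.le
    rw [h3 _ k (Or.inr hk.ne'), hk'] at this
    omega
  · have := T.col_lt (i := p.1) (i' := i) j (by omega)
    rw [h3 i j (Or.inl (by rintro rfl; omega))] at this
    omega

theorem DecStep.mem_DSet_iff_of_ne (h : DecStep r c t p T T') (hqp : q ≠ p) :
    q ∈ DSet r c t T ↔ q ∈ DSet r c t T' := by
  simp only [DSet, Finset.mem_filter, Finset.mem_univ, true_and]
  exact and_congr_right fun hq => by rw [h.decCount_eq_of_ne hq hqp]

theorem DecStep.mem_ESet_iff_of_ne (h : DecStep r c t p T T') (hqp : q ≠ p) :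
    q ∈ ESet r c t T ↔ q ∈ ESet r c t T' := by
  simp only [ESet, Finset.mem_filter, Finset.mem_univ, true_and]
  refine and_congr_right fun hq => and_congr_right fun _ => exists_congr fun k => ?_
  rw [h.decCount_eq_of_ne hq hqp]
  obtain ⟨hp, j, h1, h2, h3⟩ := h
  obtain ⟨i, v⟩ := p
  obtain ⟨i', v'⟩ := q
  simp only at hp h1 h2 h3 hq ⊢
  have hrow : ∀ l, T.1 i' l = v' ↔ T'.1 i' l = v' := by
    intro l
    by_cases hl : i' ≠ i ∨ l ≠ j
    · rw [h3 _ _ hl]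
    · obtain ⟨rfl, rfl⟩ : i' = i ∧ l = j := by tauto
      have hv : (v' : ℕ) ≠ v := fun hv => hqp (by rw [Fin.ext hv])
      rw [Fin.ext_iff, Fin.ext_iff, h1, h2]
      grind
  simp only [ne_eq, hrow]
  refine and_congr_right fun hk => and_congr_right fun _ => and_congr_left fun _ =>
    forall_congr' fun i'' => imp_congr_right fun hi'' => ?_
  by_cases hl : i'' ≠ i ∨ k ≠ j
  · rw [h3 _ _ hl]
  · obtain ⟨rfl, rfl⟩ : i'' = i ∧ k = j := by tauto
    have := T'.col_lt (i := i') (i' := i'') k (by omega)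
    rw [hk] at this
    rw [h1, h2]
    grind

theorem DecStep.norm_eq (h : DecStep r c t p T T') :
    normSSYT r c t T = normSSYT r c t T' + 1 := by
  obtain ⟨hp, j, h1, h2, h3⟩ := h
  unfold normSSYT
  rw [← Finset.add_sum_erase _ _ (Finset.mem_univ p.1),
    ← Finset.add_sum_erase _ (fun i => ∑ j, (T'.1 i j : ℕ)) (Finset.mem_univ p.1),
    ← Finset.add_sum_erase _ _ (Finset.mem_univ j),
    ← Finset.add_sum_erase _ (fun j => (T'.1 p.1 j : ℕ)) (Finset.mem_univ j), h1, h2]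
  have e1 : ∑ k ∈ Finset.univ.erase j, (T.1 p.1 k : ℕ) =
      ∑ k ∈ Finset.univ.erase j, (T'.1 p.1 k : ℕ) :=
    Finset.sum_congr rfl fun k hk => by rw [h3 _ k (Or.inr (Finset.ne_of_mem_erase hk))]
  have e2 : ∑ i ∈ Finset.univ.erase p.1, ∑ k, (T.1 i k : ℕ) =
      ∑ i ∈ Finset.univ.erase p.1, ∑ k, (T'.1 i k : ℕ) :=
    Finset.sum_congr rfl fun i hi => Finset.sum_congr rfl fun k _ => by
      rw [h3 i k (Or.inl (Finset.ne_of_mem_erase hi))]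
  rw [e1, e2]
  ring

theorem DecStep.down_unique {T₁ T₂ : SSYT r c t} (h : DecStep r c t p T T₁)
    (h' : DecStep r c t p T T₂) : T₁ = T₂ := by
  obtain ⟨-, j, h1, h2, h3⟩ := h
  obtain ⟨-, j', h1', h2', h3'⟩ := h'
  obtain rfl : j = j' := by
    rcases lt_trichotomy j j' with hj | hj | hj
    · have := T₂.row_le p.1 hj.le
      rw [← h3' _ _ (Or.inr hj.ne)] at this
      omega
    · exact hj
    · have := T₁.row_le p.1 hj.le
      rw [← h3 _ _ (Or.inr hj.ne)] at this
      omega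
  refine Subtype.ext (funext fun i => funext fun k => ?_)
  by_cases hl : i ≠ p.1 ∨ k ≠ j
  · rw [← h3 _ _ hl, ← h3' _ _ hl]
  · obtain ⟨rfl, rfl⟩ : i = p.1 ∧ k = j := by tauto
    exact Fin.ext (h2.trans h2'.symm)

theorem DecStep.up_unique {T₁ T₂ : SSYT r c t} (h : DecStep r c t p T₁ T)
    (h' : DecStep r c t p T₂ T) : T₁ = T₂ := by
  obtain ⟨-, j, h1, h2, h3⟩ := h
  obtain ⟨-, j', h1', h2', h3'⟩ := h'
  obtain rfl : j = j' := by
    rcases lt_trichotomy j j' with hj | hj | hj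
    · have := T₁.row_le p.1 hj.le
      rw [h3 _ j' (Or.inr hj.ne')] at this
      omega
    · exact hj
    · have := T₂.row_le p.1 hj.le
      rw [h3' _ j (Or.inr hj.ne')] at this
      omega
  refine Subtype.ext (funext fun i => funext fun k => ?_)
  by_cases hl : i ≠ p.1 ∨ k ≠ j
  · rw [h3 _ _ hl, h3' _ _ hl]
  · obtain ⟨rfl, rfl⟩ : i = p.1 ∧ k = j := by tauto
    exact Fin.ext (h1.trans h1'.symm)

/-- Changing one entry of a semistandard tableau keeps it semistandard if the new entry fits with
the rest of its row and column. -/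
theorem SSYT.cond_update (T : SSYT r c t) (i : Fin r) (j : Fin c) (w : Fin (r + t))
    (left : ∀ k < j, T.1 i k ≤ w) (right : ∀ k, j < k → w ≤ T.1 i k)
    (above : ∀ i' < i, T.1 i' j < w) (below : ∀ i', i < i' → w < T.1 i' j) :
    SSYTCond r c t (fun i' k => if i' = i ∧ k = j then w else T.1 i' k) := by
  refine ⟨fun i' k k' hk => ?_, fun i₁ i₂ k hi => ?_⟩
  · have := T.2.1 i' k k' hk
    grind
  · have := T.2.2 i₁ i₂ k hi
    grind

theorem exists_decStep_of_mem_DSet (h : p ∈ DSet r c t T) : ∃ T', DecStep r c t p T T' := by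
  obtain ⟨hp, hodd⟩ := (Finset.mem_filter.1 h).2
  obtain ⟨j₀, hj₀⟩ := Finset.card_pos.1 hodd.pos
  obtain ⟨j, hj, hmin⟩ : ∃ j, (T.1 p.1 j : ℕ) = p.2 + 1 ∧
      ∀ k < j, (T.1 p.1 k : ℕ) ≠ p.2 + 1 := by
    obtain ⟨j, hj⟩ := (Set.toFinite {j : Fin c | (T.1 p.1 j : ℕ) = p.2 + 1}).exists_minimal
      ⟨j₀, (Finset.mem_filter.1 hj₀).2.1⟩
    exact ⟨j, hj.prop, fun k hk hk' => hj.not_lt hk' hk⟩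
  have hjj₀ : j ≤ j₀ := by
    by_contra! hlt
    exact hmin _ hlt (Finset.mem_filter.1 hj₀).2.1
  have habove : ∀ i' < p.1, (T.1 i' j : ℕ) < p.2 := by
    intro i' hi'
    have hi1 : (p.1 : ℕ) - 1 < r := by omega
    have hlt := Fin.lt_def.1 hi'
    have h1 := (Finset.mem_filter.1 hj₀).2.2 ⟨(p.1 : ℕ) - 1, hi1⟩ (by simp; omega)
    have h2 := T.col_lt (i := ⟨(p.1 : ℕ) - 1, hi1⟩) (i' := p.1) j₀ (by simp; omega)
    have h3 := T.row_le ⟨(p.1 : ℕ) - 1, hi1⟩ hjj₀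
    have h4 : T.1 i' j ≤ T.1 ⟨(p.1 : ℕ) - 1, hi1⟩ j := by
      rcases Nat.lt_or_ge i' ((p.1 : ℕ) - 1) with h | h
      · exact (T.2.2 _ _ j h).le
      · rw [show i' = ⟨(p.1 : ℕ) - 1, hi1⟩ from Fin.ext (by simp; omega)]
    have h5 := (Finset.mem_filter.1 hj₀).2.1
    have h4' := Fin.le_def.1 h4
    omega
  refine ⟨⟨_, T.cond_update p.1 j p.2 ?_ ?_ ?_ ?_⟩, hp, j, hj, by simp, ?_⟩
  · intro k hk
    have := T.row_le p.1 hk.le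
    have := hmin k hk
    rw [Fin.le_def]
    omega
  · intro k hk
    have := T.row_le p.1 hk.le
    rw [Fin.le_def]
    omega
  · exact habove
  · intro i' hi'
    have := T.col_lt j (Fin.lt_def.1 hi')
    rw [Fin.lt_def]
    omega
  · intro i k hik
    simp only
    rw [if_neg (by tauto)]

theorem exists_decStep_of_mem_ESet (h : p ∈ ESet r c t T') : ∃ T, DecStep r c t p T T' := by
  obtain ⟨hp, hlt, j, hj, hmax, hbelow, -⟩ := (Finset.mem_filter.1 h).2
  have hj' := Fin.ext_iff.1 hj
  refine ⟨⟨_, T'.cond_update p.1 j ⟨p.2 + 1, by omega⟩ ?_ ?_ ?_ ?_⟩, hp, j, by simp, hj', ?_⟩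
  · intro k hk
    have := T'.row_le p.1 hk.le
    rw [Fin.le_def]
    simp only
    omega
  · intro k hk
    have := T'.row_le p.1 hk.le
    have := Fin.val_ne_of_ne (hmax k hk)
    rw [Fin.le_def]
    simp only
    omega
  · intro i' hi'
    have := T'.col_lt j (Fin.lt_def.1 hi')
    rw [Fin.lt_def]
    simp only
    omega
  · intro i' hi'
    have hi := Fin.lt_def.1 hi'
    have h1 : (p.1 : ℕ) + 1 < r := by omega
    have h2 := hbelow ⟨(p.1 : ℕ) + 1, h1⟩ rfl
    have h3 := T'.col_lt (i := p.1) (i' := ⟨(p.1 : ℕ) + 1, h1⟩) j (by simp)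
    have h4 : T'.1 ⟨(p.1 : ℕ) + 1, h1⟩ j ≤ T'.1 i' j := by
      rcases Nat.lt_or_ge ((p.1 : ℕ) + 1) i' with h | h
      · exact (T'.2.2 _ _ j h).le
      · rw [show i' = ⟨(p.1 : ℕ) + 1, h1⟩ from Fin.ext (by simp; omega)]
    have h4' := Fin.le_def.1 h4
    rw [Fin.lt_def]
    simp only
    omega
  · intro i k hik
    simp only
    rw [if_neg (by tauto)]

theorem isBottom_iff_DSet_eq_empty : IsBottom r c t T ↔ DSet r c t T = ∅ := by
  simp only [IsBottom, DSet, Finset.filter_eq_empty_iff, Finset.mem_univ, true_imp_iff, not_and,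
    Nat.not_odd_iff_even]
  refine ⟨fun h p hp => h p.1 _ hp.add_one, fun h i v hv => ?_⟩
  by_contra ho
  obtain ⟨j, hj⟩ := Finset.card_pos.1 (Nat.not_even_iff_odd.1 ho).pos
  have hjv := (Finset.mem_filter.1 hj).2.1
  have hlt := (T.1 i j).2
  have hv0 := hv.pos
  have h' := @h (i, ⟨v - 1, by omega⟩) (Nat.Odd.sub_odd hv odd_one)
  exact ho ((Nat.sub_add_cancel hv0 : v - 1 + 1 = v) ▸ h')

end

/-- (Corollary 5.9.) The decomposition of `SSYT(r,c,t)` into Boolean algebras yields the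
expansion `∑_{T ∈ SSYT(r,c,t)} q^{‖T‖} = ∑_{T ∈ Bottom(r,c,t)} q^{‖T‖} (1+q)^{|E(T)|}`
of the principally specialized Schur function `s_{(c^r)}(1, q, …, q^{r+t−1})`. -/
theorem schur_principal_specialization_boolean_expansion (r c t : ℕ)
    (hr : 0 < r) (hc : 0 < c) (ht : 0 < t) :
    (∑ T : SSYT r c t, (Polynomial.X : Polynomial ℤ) ^ normSSYT r c t T) =
      ∑ T ∈ Finset.univ.filter (IsBottom r c t),
        (Polynomial.X : Polynomial ℤ) ^ normSSYT r c t T *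
          (1 + Polynomial.X) ^ (ESet r c t T).card := by
  rw [sum_X_pow_eq_sum_bottom (DSet r c t) (ESet r c t) (normSSYT r c t) (DecStep r c t)
    (fun _ _ => exists_decStep_of_mem_DSet) (fun _ _ => exists_decStep_of_mem_ESet)
    (fun _ _ _ _ => DecStep.down_unique) (fun _ _ _ _ => DecStep.up_unique)
    (fun _ _ _ => DecStep.mem_DSet_iff_mem_ESet) (fun _ _ _ => DecStep.norm_eq)
    (fun _ _ _ h _ => h.mem_DSet_iff_of_ne) (fun _ _ _ h _ => h.mem_ESet_iff_of_ne)
    fun p T hE hD => ?_]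
  · refine Finset.sum_congr ?_ fun _ _ => rfl
    ext T
    simp [isBottom_iff_DSet_eq_empty]
  · obtain ⟨-, -, -, -, -, -, he⟩ := (Finset.mem_filter.1 hE).2
    exact Nat.not_even_iff_odd.2 (Finset.mem_filter.1 hD).2.2 he
end

section
/- For every odd integer b > 1 there exists a subgroup G of Equiv.Perm (Fin (2b)) such that G acts transitively on Fin (2b) and every element of G whose order is a power of 2 has a fixed point on Fin (2b) (i.e. G contains no derangement of 2-power order). -/
/-- The permutation `(x, e) ↦ (x + i, e + v x)` of `ZMod b × ZMod 2`. -/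
def twistedShift {b : ℕ} (i : ZMod b) (v : ZMod b → ZMod 2) :
    Equiv.Perm (ZMod b × ZMod 2) where
  toFun p := (p.1 + i, p.2 + v p.1)
  invFun p := (p.1 - i, p.2 - v (p.1 - i))
  left_inv p := by simp
  right_inv p := by simp

@[simp]
theorem twistedShift_apply {b : ℕ} (i : ZMod b) (v : ZMod b → ZMod 2) (p : ZMod b × ZMod 2) :
    twistedShift i v p = (p.1 + i, p.2 + v p.1) := rfl

/-- The group of all twisted shifts whose twist sums to zero: the semidirect product of the
even-weight binary code of length `b` with the cyclic group of order `b`. -/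
def evenTwistedShiftGroup (b : ℕ) [NeZero b] : Subgroup (Equiv.Perm (ZMod b × ZMod 2)) where
  carrier := {g | ∃ (i : ZMod b) (v : ZMod b → ZMod 2), ∑ x, v x = 0 ∧ g = twistedShift i v}
  one_mem' := ⟨0, 0, by simp, by ext p <;> simp⟩
  mul_mem' := by
    rintro _ _ ⟨i, v, hv, rfl⟩ ⟨j, w, hw, rfl⟩
    refine ⟨j + i, fun x => w x + v (x + j), ?_, ?_⟩
    · rw [Finset.sum_add_distrib, hw, zero_add]
      exact (Equiv.sum_comp (Equiv.addRight j) v).trans hv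
    · ext p <;> simp [add_assoc]
  inv_mem' := by
    rintro _ ⟨i, v, hv, rfl⟩
    refine ⟨-i, fun x => -v (x + -i), ?_, ?_⟩
    · rw [Finset.sum_neg_distrib, neg_eq_zero]
      exact (Equiv.sum_comp (Equiv.addRight (-i)) v).trans hv
    · rw [inv_eq_iff_mul_eq_one]
      ext p <;> simp [add_assoc, CharTwo.add_self_eq_zero]

theorem twistedShift_pow_apply_fst {b : ℕ} (i : ZMod b) (v : ZMod b → ZMod 2) (k : ℕ)
    (p : ZMod b × ZMod 2) : ((twistedShift i v ^ k) p).1 = p.1 + k * i := by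
  induction k with
  | zero => simp
  | succ k ih =>
    rw [pow_succ', Equiv.Perm.mul_apply, twistedShift_apply, ih]
    push_cast
    ring

theorem exists_mem_evenTwistedShiftGroup_apply_eq {b : ℕ} [NeZero b] (hb : 1 < b)
    (p q : ZMod b × ZMod 2) : ∃ g ∈ evenTwistedShiftGroup b, g p = q := by
  have : Fact (1 < b) := ⟨hb⟩
  let v : ZMod b → ZMod 2 := Pi.single p.1 (q.2 - p.2) + Pi.single (p.1 + 1) (q.2 - p.2)
  refine ⟨twistedShift (q.1 - p.1) v, ⟨_, v, ?_, rfl⟩, ?_⟩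
  · simp [v, Finset.sum_add_distrib, CharTwo.add_self_eq_zero]
  · ext <;> simp [v]

theorem exists_apply_eq_of_mem_evenTwistedShiftGroup {b : ℕ} [NeZero b] (hodd : Odd b)
    {g : Equiv.Perm (ZMod b × ZMod 2)} (hg : g ∈ evenTwistedShiftGroup b) {m : ℕ}
    (hm : g ^ 2 ^ m = 1) : ∃ p, g p = p := by
  obtain ⟨i, v, hv, rfl⟩ := hg
  have hi : i = 0 := by
    have h := twistedShift_pow_apply_fst i v (2 ^ m) 0
    have hu : IsUnit ((2 ^ m : ℕ) : ZMod b) :=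
      (ZMod.isUnit_iff_coprime _ _).2 (hodd.coprime_two_left.pow_left m)
    rw [hm] at h
    exact hu.mul_right_eq_zero.1 (by simpa using h.symm)
  obtain ⟨x, hx⟩ : ∃ x, v x = 0 := by
    by_contra! h
    have h1 : ∀ x, v x = 1 := fun x => Fin.eq_one_of_ne_zero _ (h x)
    simp [h1, ZMod.natCast_eq_zero_iff_even] at hv
    exact Nat.not_even_iff_odd.2 hodd hv
  exact ⟨(x, 0), by simp [hi, hx]⟩

/-- (Proposition 6.2, Isbell's construction.) For every odd `b > 1` there is a transitive
subgroup of `𝔖_{2b}` in which every element of `2`-power order has a fixed point, i.e. which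
contains no derangement of `2`-power order. -/
theorem exists_transitive_subgroup_no_two_power_derangement (b : ℕ) (hb : 1 < b)
    (hodd : Odd b) :
    ∃ G : Subgroup (Equiv.Perm (Fin (2 * b))),
      (∀ x y : Fin (2 * b), ∃ g ∈ G, g x = y) ∧
      ∀ g ∈ G, (∃ m : ℕ, orderOf g = 2 ^ m) → ∃ x : Fin (2 * b), g x = x := by
  have : NeZero b := ⟨by omega⟩
  let φ : Fin (2 * b) ≃ ZMod b × ZMod 2 :=
    Fintype.equivOfCardEq (by simp [ZMod.card, mul_comm])
  refine ⟨(evenTwistedShiftGroup b).comap φ.permCongrHom.toMonoidHom, fun x y => ?_, ?_⟩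
  · obtain ⟨g, hg, hgxy⟩ := exists_mem_evenTwistedShiftGroup_apply_eq hb (φ x) (φ y)
    refine ⟨φ.permCongrHom.symm g, ?_, ?_⟩
    · rw [Subgroup.mem_comap]
      exact (φ.permCongrHom.apply_symm_apply g).symm ▸ hg
    · simp [Equiv.permCongrHom, hgxy]
  · rintro g hg ⟨m, hm⟩
    obtain ⟨p, hp⟩ := exists_apply_eq_of_mem_evenTwistedShiftGroup hodd
      (Subgroup.mem_comap.1 hg) (m := m) (by rw [← map_pow, ← hm, pow_orderOf_eq_one, map_one])
    exact ⟨φ.symm p, φ.injective (by simpa [Equiv.permCongrHom] using hp)⟩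
end

section
/- (Isbell's criterion.) Let n be a positive even integer and G a subgroup of Equiv.Perm (Fin n). Then G has a self-complementary orbit on the (n/2)-element subsets of Fin n if and only if G contains a fixed-point-free element whose order is a power of 2. -/
open MulAction Pointwise

/-- A permutation of 2-power order fixes no point under an odd power unless it fixes that point. -/
theorem Equiv.Perm.even_of_zpow_apply_eq_self {α : Type*} {g : Equiv.Perm α} {m : ℕ}
    (hm : orderOf g = 2 ^ m) {x : α} (hx : g x ≠ x) {k : ℤ} (hk : (g ^ k) x = x) : Even k := by
  by_contra hodd
  rw [Int.not_even_iff_odd] at hodd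
  have hcop : IsCoprime k ((2 : ℤ) ^ m) := (Int.isCoprime_two_right.mpr hodd).pow_right
  obtain ⟨u, v, huv⟩ := hcop
  have hpow : g ^ ((2 : ℤ) ^ m) = 1 := by
    have h := pow_orderOf_eq_one g
    rw [hm] at h
    exact_mod_cast h
  have hg : (g ^ k) ^ u = g := by
    calc (g ^ k) ^ u = g ^ (u * k + v * 2 ^ m) := by
          rw [zpow_add, mul_comm v, zpow_mul g (2 ^ m), hpow, one_zpow, mul_one, mul_comm u,
            zpow_mul]
      _ = g := by rw [huv, zpow_one]
  apply hx
  conv_lhs => rw [← hg]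
  exact Equiv.Perm.zpow_apply_eq_self_of_apply_eq_self hk u

/-- A fixed-point-free permutation of 2-power order swaps some set with its complement. -/
theorem Equiv.Perm.exists_apply_mem_iff_notMem {α : Type*} {g : Equiv.Perm α} {m : ℕ}
    (hm : orderOf g = 2 ^ m) (hg : ∀ x, g x ≠ x) : ∃ S : Set α, ∀ x, g x ∈ S ↔ x ∉ S := by
  let rep : α → α := fun x => (Quotient.mk (Equiv.Perm.SameCycle.setoid g) x).out
  have hrep : ∀ x, g.SameCycle (rep x) x := fun x =>
    Quotient.mk_out (s := Equiv.Perm.SameCycle.setoid g) x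
  have hrepg : ∀ x, rep (g x) = rep x := fun x =>
    congrArg Quotient.out (Quotient.sound (s := Equiv.Perm.SameCycle.setoid g)
      (Equiv.Perm.sameCycle_apply_left.mpr (Equiv.Perm.SameCycle.refl g x)))
  have hparity : ∀ {x : α} {k l : ℤ}, (g ^ k) (rep x) = x → (g ^ l) (rep x) = x →
      (Even k ↔ Even l) := by
    intro x k l hk hl
    have h : (g ^ (k - l)) x = x := by
      nth_rw 1 [← hl]
      rw [← Equiv.Perm.mul_apply, ← zpow_add, sub_add_cancel, hk]
    exact Int.even_sub.mp (even_of_zpow_apply_eq_self hm (hg x) h)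
  refine ⟨{x | ∃ k : ℤ, Even k ∧ (g ^ k) (rep x) = x}, fun x => ?_⟩
  obtain ⟨k, hk⟩ := hrep x
  have hk' : (g ^ (k + 1)) (rep (g x)) = g x := by
    rw [hrepg, add_comm, zpow_add, zpow_one, Equiv.Perm.mul_apply, hk]
  have hmem : ∀ {y : α} {j : ℤ}, (g ^ j) (rep y) = y →
      ((∃ l : ℤ, Even l ∧ (g ^ l) (rep y) = y) ↔ Even j) := fun hj =>
    ⟨fun ⟨_, hl, hly⟩ => (hparity hly hj).mp hl, fun h => ⟨_, h, hj⟩⟩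
  simp only [Set.mem_ofPred_eq, hmem hk, hmem hk', Int.even_add_one]

/-- The pointwise action on finsets commutes with complements. -/
theorem Finset.smul_finset_compl {α β : Type*} [Fintype β] [DecidableEq β] [Group α]
    [MulAction α β] (a : α) (s : Finset β) : a • sᶜ = (a • s)ᶜ := by
  rw [compl_eq_univ_sdiff, smul_finset_sdiff, smul_finset_univ, compl_eq_univ_sdiff]

/-- If `g • S = Sᶜ`, then `S` and its complement are swapped by every odd power of `g`. -/
theorem Finset.pow_smul_eq_compl_of_odd {α : Type*} [Fintype α] [DecidableEq α]
    {g : Equiv.Perm α} {S : Finset α} (h : g • S = Sᶜ) {k : ℕ} (hk : Odd k) :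
    g ^ k • S = Sᶜ := by
  obtain ⟨j, rfl⟩ := hk
  have hsq : g ^ 2 ∈ stabilizer (Equiv.Perm α) S := by
    rw [mem_stabilizer_iff, pow_two, mul_smul, h, Finset.smul_finset_compl, h, compl_compl]
  have hev : g ^ (2 * j) • S = S := by
    rw [pow_mul]
    exact mem_stabilizer_iff.mp (pow_mem hsq j)
  rw [pow_succ', mul_smul, hev, h]

/-- (Isbell's criterion, Section 6.) For `n` even, `G ≤ 𝔖_n` has a self-complementary orbit on
the `n/2`-element subsets of `Fin n` if and only if `G` contains a fixed-point-free element of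
`2`-power order. -/
theorem isbell_criterion (n : ℕ) (hn : 0 < n) (he : Even n)
    (G : Subgroup (Equiv.Perm (Fin n))) :
    (∃ S : Finset (Fin n), S.card = n / 2 ∧
        (fun T => (Finset.univ : Finset (Fin n)) \ T) '' orbit G S = orbit G S) ↔
      ∃ g ∈ G, (∃ m : ℕ, orderOf g = 2 ^ m) ∧ ∀ x : Fin n, g x ≠ x := by
  simp only [← Finset.compl_eq_univ_sdiff]
  constructor
  · rintro ⟨S, -, hS⟩
    have hmem : Sᶜ ∈ orbit G S := hS ▸ Set.mem_image_of_mem _ (mem_orbit_self S)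
    obtain ⟨⟨g, hgG⟩, hg : g • S = Sᶜ⟩ := hmem
    obtain ⟨m, k, hk, hord⟩ := Nat.exists_eq_two_pow_mul_odd (orderOf_pos g).ne'
    refine ⟨g ^ k, pow_mem hgG k, ⟨m, ?_⟩, fun x hx => ?_⟩
    · rw [orderOf_pow_of_dvd hk.pos.ne' (hord ▸ dvd_mul_left k _), hord,
        Nat.mul_div_cancel _ hk.pos]
    · have h : (g ^ k) • x ∈ g ^ k • S ↔ x ∈ S := Finset.smul_mem_smul_finset_iff _
      rw [Finset.pow_smul_eq_compl_of_odd hg hk, Equiv.Perm.smul_def, hx, Finset.mem_compl] at h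
      tauto
  · rintro ⟨g, hgG, ⟨m, hm⟩, hfree⟩
    classical
    obtain ⟨A, hA⟩ := Equiv.Perm.exists_apply_mem_iff_notMem hm hfree
    obtain ⟨S, rfl⟩ : ∃ S : Finset (Fin n), (S : Set (Fin n)) = A := ⟨A.toFinset, by simp⟩
    have hgS : g • S = Sᶜ := by
      ext x
      rw [← Finset.inv_smul_mem_iff, Equiv.Perm.smul_def, Finset.mem_compl]
      have h := hA (g⁻¹ x)
      rw [← Equiv.Perm.mul_apply, mul_inv_cancel, Equiv.Perm.one_apply, Finset.mem_coe, Finset.mem_coe] at h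
      tauto
    refine ⟨S, ?_, ?_⟩
    · have h := S.card_add_card_compl
      rw [← hgS, Finset.card_smul_finset, Fintype.card_fin] at h
      omega
    · have hsub : compl '' orbit G S ⊆ orbit G S := by
        rintro _ ⟨_, ⟨a, rfl⟩, rfl⟩
        refine ⟨a * ⟨g, hgG⟩, ?_⟩
        change (a.1 * g) • S = (a.1 • S)ᶜ
        rw [mul_smul, hgS, Finset.smul_finset_compl]
      exact hsub.antisymm fun T hT => ⟨Tᶜ, hsub ⟨T, hT, rfl⟩, compl_compl T⟩
end

section
/- Let n > 2 and let C_n be the cyclic subgroup of Equiv.Perm (Fin n) generated by an n-cycle. Then: (1) in ℤ[q], n · ∑_{Ω} q^{w(Ω)} = ∑_{d ∣ n} φ(d)·(1 + q^d)^{n/d}, where the sum on the left ranges over all C_n-orbits Ω of subsets of Fin n; and (2) n · (the number of self-complementary C_n-orbits of subsets of Fin n) = ∑_{d ∣ n, d even} φ(d)·2^{n/d}. -/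
open MulAction Pointwise
open scoped Classical

theorem card_filter_quotient_mk_eq {G X : Type*} [Group G] [Fintype G] [MulAction G X] [Fintype X]
    (r : X) :
    (Finset.univ.filter fun x => (Quotient.mk'' x : orbitRel.Quotient G X) = Quotient.mk'' r).card
      * Nat.card (stabilizer G r) = Fintype.card G := by
  rw [Nat.card_eq_fintype_card, ← card_orbit_mul_card_stabilizer_eq_card_group G r,
    ← Fintype.card_subtype]
  congr 1
  refine Fintype.card_congr (Equiv.subtypeEquivRight fun x => ?_)
  rw [Quotient.eq'']
  rfl

theorem card_filter_smul_eq {G X : Type*} [Group G] [Fintype G] [MulAction G X] {x y : X}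
    (hy : y ∈ orbit G x) :
    (Finset.univ.filter fun g : G => g • x = y).card = Nat.card (stabilizer G x) := by
  obtain ⟨h, rfl⟩ := hy
  rw [Nat.card_eq_fintype_card, ← Fintype.card_subtype]
  refine Fintype.card_congr ((Equiv.mulLeft h⁻¹).subtypeEquiv fun g => ?_)
  simp [mem_stabilizer_iff, mul_smul, inv_smul_eq_iff]

/-- Burnside's lemma with an invariant weight `w`, twisted by an equivariant map `c`. -/
theorem sum_sum_filter_smul_eq {G X R : Type*} [Group G] [Fintype G] [MulAction G X] [Fintype X]
    [Fintype (orbitRel.Quotient G X)] [CommSemiring R] (c : X → X)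
    (hc : ∀ (g : G) x, c (g • x) = g • c x) (w : X → R) (hw : ∀ (g : G) x, w (g • x) = w x) :
    ∑ g : G, ∑ x with g • x = c x, w x =
      (Fintype.card G : R) *
        ∑ Ω : orbitRel.Quotient G X with c Ω.out ∈ orbit G Ω.out, w Ω.out := by
  simp_rw [Finset.sum_filter]
  rw [Finset.sum_comm, Finset.mul_sum,
    ← Finset.sum_fiberwise Finset.univ (fun x => (Quotient.mk'' x : orbitRel.Quotient G X))]
  refine Finset.sum_congr rfl fun Ω _ => ?_
  have hΩ : (Quotient.mk'' Ω.out : orbitRel.Quotient G X) = Ω := Quotient.out_eq' Ω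
  have hconst : ∀ x ∈ Finset.univ.filter
      (fun x => (Quotient.mk'' x : orbitRel.Quotient G X) = Ω),
      (∑ g : G, if g • x = c x then w x else 0) =
        ∑ g : G, if g • Ω.out = c Ω.out then w Ω.out else 0 := by
    intro x hx
    rw [Finset.mem_filter, ← hΩ, Quotient.eq''] at hx
    obtain ⟨h, hh⟩ := hx.2
    rw [← hh, hw, hc]
    refine Fintype.sum_equiv (MulAut.conj h⁻¹).toEquiv _ _ fun g => ?_
    simp [mul_smul, inv_smul_eq_iff]
  rw [Finset.sum_congr rfl hconst, Finset.sum_const, ← Finset.sum_filter, Finset.sum_const]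
  split_ifs with hmem
  · rw [card_filter_smul_eq hmem, ← card_filter_quotient_mk_eq (G := G) Ω.out, hΩ]
    simp [nsmul_eq_mul, mul_assoc]
  · rw [Finset.filter_false_of_mem fun g _ hg => hmem ⟨g, hg⟩]
    simp

theorem mem_iff_mem_of_smul_eq_self {α : Type*} [DecidableEq α] {g : Equiv.Perm α}
    {S : Finset α} (hS : g • S = S) {x y : α}
    (hxy : (Quotient.mk'' x : orbitRel.Quotient (Subgroup.zpowers g) α) = Quotient.mk'' y) :
    x ∈ S ↔ y ∈ S := by
  rw [Quotient.eq''] at hxy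
  obtain ⟨⟨h, hh⟩, rfl⟩ := hxy
  have hle : Subgroup.zpowers g ≤ stabilizer (Equiv.Perm α) S := by
    rwa [Subgroup.zpowers_le, mem_stabilizer_iff]
  have hfix : h • S = S := hle hh
  change h • y ∈ S ↔ y ∈ S
  conv_lhs => rw [← hfix]
  exact Finset.smul_mem_smul_finset_iff h

section Semiregular

variable {α : Type*} [Fintype α] [DecidableEq α] {g : Equiv.Perm α}

theorem card_filter_quotient_mk_eq_orderOf (hg : ∀ (k : ℤ) x, (g ^ k) x = x → g ^ k = 1)
    (q : orbitRel.Quotient (Subgroup.zpowers g) α) :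
    (Finset.univ.filter fun x =>
      (Quotient.mk'' x : orbitRel.Quotient (Subgroup.zpowers g) α) = q).card = orderOf g := by
  induction q using Quotient.inductionOn' with | _ r
  have hstab : stabilizer (Subgroup.zpowers g) r = ⊥ := by
    rw [eq_bot_iff]
    rintro ⟨_, k, rfl⟩ hk
    exact Subtype.ext (hg k r hk)
  have h := card_filter_quotient_mk_eq (G := Subgroup.zpowers g) r
  rw [hstab, Subgroup.card_bot, mul_one, Fintype.card_zpowers] at h
  exact h

theorem card_orbitRel_quotient_zpowers (hg : ∀ (k : ℤ) x, (g ^ k) x = x → g ^ k = 1) :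
    Fintype.card (orbitRel.Quotient (Subgroup.zpowers g) α) = Fintype.card α / orderOf g := by
  refine (Nat.div_eq_of_eq_mul_left (orderOf_pos g) ?_).symm
  rw [← Finset.card_univ (α := α), Finset.card_eq_sum_card_fiberwise
    (f := fun x => (Quotient.mk'' x : orbitRel.Quotient (Subgroup.zpowers g) α))
    (t := Finset.univ) (by simp)]
  simp_rw [card_filter_quotient_mk_eq_orderOf hg]
  simp

theorem sum_pow_card_filter_smul_eq_self {R : Type*} [CommSemiring R]
    (hg : ∀ (k : ℤ) x, (g ^ k) x = x → g ^ k = 1) (a : R) :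
    ∑ S : Finset α with g • S = S, a ^ S.card =
      (1 + a ^ orderOf g) ^ (Fintype.card α / orderOf g) := by
  rw [← card_orbitRel_quotient_zpowers hg, ← Finset.card_univ, ← Finset.prod_const,
    Finset.prod_one_add]
  symm
  let mk : α → orbitRel.Quotient (Subgroup.zpowers g) α := Quotient.mk''
  refine Finset.sum_bij' (fun T _ => Finset.univ.filter fun x => mk x ∈ T)
    (fun S _ => S.image mk) ?_ ?_ ?_ ?_ ?_
  · intro T _
    rw [Finset.mem_filter]
    refine ⟨Finset.mem_univ _, ?_⟩
    ext x
    have hx : mk (g⁻¹ • x) = mk x :=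
      Quotient.sound' ⟨⟨g⁻¹, inv_mem (Subgroup.mem_zpowers g)⟩, rfl⟩
    rw [← Finset.inv_smul_mem_iff, Finset.mem_filter, Finset.mem_filter, hx]
    simp
  · simp
  · intro T _
    ext q
    induction q using Quotient.inductionOn' with | _ r
    simp only [Finset.mem_image, Finset.mem_filter, Finset.mem_univ, true_and]
    exact ⟨fun ⟨x, hx, hxr⟩ => hxr ▸ hx, fun hr => ⟨r, hr, rfl⟩⟩
  · intro S hS
    ext x
    simp only [Finset.mem_image, Finset.mem_filter, Finset.mem_univ, true_and] at hS ⊢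
    exact ⟨fun ⟨y, hy, hyx⟩ => (mem_iff_mem_of_smul_eq_self hS hyx).1 hy, fun hx => ⟨x, hx, rfl⟩⟩
  · intro T _
    rw [Finset.prod_const, ← pow_mul, Finset.card_eq_sum_card_fiberwise (f := mk) (t := T)
      (by intro x hx; simpa using hx)]
    congr 1
    rw [mul_comm, ← smul_eq_mul, ← Finset.sum_const]
    refine Finset.sum_congr rfl fun q hq => ?_
    rw [← card_filter_quotient_mk_eq_orderOf hg q, Finset.filter_filter]
    congr 1
    ext x
    simp only [Finset.mem_filter, Finset.mem_univ, true_and]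
    exact ⟨fun hx => ⟨by rwa [show mk x = q from hx], hx⟩, fun hx => hx.2⟩

theorem exists_smul_eq_compl (hg : ∀ (k : ℤ) x, (g ^ k) x = x → g ^ k = 1)
    (heven : Even (orderOf g)) : ∃ S : Finset α, g • S = Sᶜ := by
  let r : α → α := fun x => (Quotient.mk'' x : orbitRel.Quotient (Subgroup.zpowers g) α).out
  have hr : ∀ x, ∃ k : ℤ, (g ^ k) (r x) = x := fun x => by
    have h : (orbitRel (Subgroup.zpowers g) α) x (r x) :=
      Setoid.symm' _ (Quotient.mk_out (s := orbitRel (Subgroup.zpowers g) α) x)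
    obtain ⟨⟨_, k, rfl⟩, hk⟩ := h
    exact ⟨k, hk⟩
  have hrinv : ∀ x, r (g⁻¹ x) = r x := fun x =>
    congrArg Quotient.out (Quotient.sound' ⟨⟨g⁻¹, inv_mem (Subgroup.mem_zpowers g)⟩, rfl⟩)
  have hparity : ∀ (x : α) (i j : ℤ), (g ^ i) x = (g ^ j) x → (Even i ↔ Even j) := by
    intro x i j hij
    have h1 : (g ^ (i - j)) x = x := by
      rw [sub_eq_neg_add, zpow_add, Equiv.Perm.mul_apply, hij, ← Equiv.Perm.mul_apply, ← zpow_add]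
      simp
    have h2 : (2 : ℤ) ∣ i - j :=
      (Int.natCast_dvd_natCast.2 heven.two_dvd).trans (orderOf_dvd_iff_zpow_eq_one.2 (hg _ x h1))
    rw [← even_iff_two_dvd, Int.even_sub] at h2
    exact h2
  refine ⟨Finset.univ.filter fun x => ∃ k : ℤ, Even k ∧ (g ^ k) (r x) = x, ?_⟩
  ext x
  rw [← Finset.inv_smul_mem_iff, Finset.mem_compl]
  simp only [Finset.mem_filter, Finset.mem_univ, true_and, Equiv.Perm.smul_def, hrinv]
  obtain ⟨k, hk⟩ := hr x
  have hk' : (g ^ (k - 1)) (r x) = g⁻¹ x := by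
    rw [sub_eq_neg_add, zpow_add, Equiv.Perm.mul_apply, hk, zpow_neg_one]
  constructor
  · rintro ⟨i, hi, hix⟩ ⟨j, hj, hjx⟩
    have h1 := hparity _ _ _ (hix.trans hk'.symm)
    have h2 := hparity _ _ _ (hjx.trans hk.symm)
    rw [Int.even_sub_one] at h1
    tauto
  · intro h
    refine ⟨k - 1, Int.even_sub_one.2 fun hke => h ⟨k, hke, hk⟩, hk'⟩

theorem Equiv.Perm.smul_finset_compl (g : Equiv.Perm α) (S : Finset α) : g • Sᶜ = (g • S)ᶜ := by
  ext x
  simp [← Finset.inv_smul_mem_iff]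

theorem card_filter_smul_eq_compl [Nonempty α] (hg : ∀ (k : ℤ) x, (g ^ k) x = x → g ^ k = 1) :
    (Finset.univ.filter fun S : Finset α => g • S = Sᶜ).card =
      if Even (orderOf g) then 2 ^ (Fintype.card α / orderOf g) else 0 := by
  split_ifs with heven
  · obtain ⟨S₀, hS₀⟩ := exists_smul_eq_compl hg heven
    have h := sum_pow_card_filter_smul_eq_self hg (1 : ℕ)
    simp only [one_pow, Finset.sum_const, smul_eq_mul, mul_one, one_add_one_eq_two] at h
    rw [← h]
    refine Finset.card_bij' (fun S _ => symmDiff S S₀) (fun S _ => symmDiff S S₀) ?_ ?_ ?_ ?_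
    · intro S hS
      simp only [Finset.mem_filter, Finset.mem_univ, true_and] at hS ⊢
      rw [Finset.smul_finset_symmDiff, hS, hS₀, compl_symmDiff_compl]
    · intro S hS
      simp only [Finset.mem_filter, Finset.mem_univ, true_and] at hS ⊢
      rw [Finset.smul_finset_symmDiff, hS, hS₀]
      ext x
      simp only [Finset.mem_symmDiff, Finset.mem_compl]
      tauto
    · simp
    · simp
  · rw [Finset.card_eq_zero, Finset.filter_eq_empty_iff]
    intro S _ hS
    have hsq : (g ^ 2) • S = S := by
      rw [pow_two, mul_smul, hS, Equiv.Perm.smul_finset_compl, hS, compl_compl]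
    have hpow : ∀ m : ℕ, (g ^ (2 * m)) • S = S := fun m => by
      rw [pow_mul]
      exact (stabilizer (Equiv.Perm α) S).pow_mem hsq m
    obtain ⟨m, hm⟩ := Nat.not_even_iff_odd.1 heven
    have h : (g ^ orderOf g) • S = Sᶜ := by rw [hm, pow_succ', mul_smul, hpow, hS]
    rw [pow_orderOf_eq_one, one_smul] at h
    exact compl_ne_self h.symm

end Semiregular

theorem IsCyclic.sum_orderOf {G R : Type*} [Group G] [Fintype G] [IsCyclic G] [CommSemiring R]
    (f : ℕ → R) :
    ∑ g : G, f (orderOf g) = ∑ d ∈ (Fintype.card G).divisors, (Nat.totient d : R) * f d := by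
  rw [← Finset.sum_fiberwise_of_maps_to (g := fun g : G => orderOf g)
    (t := (Fintype.card G).divisors)
    (fun g _ => Nat.mem_divisors.2 ⟨orderOf_dvd_card, Fintype.card_ne_zero⟩)]
  refine Finset.sum_congr rfl fun d hd => ?_
  rw [Finset.sum_congr rfl fun g hg => by rw [(Finset.mem_filter.1 hg).2], Finset.sum_const,
    IsCyclic.card_orderOf_eq_totient (Nat.dvd_of_mem_divisors hd), nsmul_eq_mul]

theorem Equiv.Perm.IsCycle.eq_one_of_mem_zpowers_of_apply_eq {α : Type*} [Fintype α]
    [DecidableEq α] {σ : Equiv.Perm α} (hcyc : σ.IsCycle) (hsupp : σ.support = Finset.univ)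
    {g : Equiv.Perm α} (hg : g ∈ Subgroup.zpowers σ) {x : α} (hx : g x = x) : g = 1 := by
  obtain ⟨k, rfl⟩ := hg
  have hmove : ∀ y, σ y ≠ y := fun y => Equiv.Perm.mem_support.1 (hsupp ▸ Finset.mem_univ y)
  ext y
  obtain ⟨j, rfl⟩ := hcyc.exists_zpow_eq (hmove x) (hmove y)
  simp only at hx ⊢
  rw [← Equiv.Perm.mul_apply, ← zpow_add, add_comm, zpow_add, Equiv.Perm.mul_apply, hx]
  rfl

/-- (Proposition 6.3, Pólya–Redfield/Burnside computation for necklaces.) For `n > 2` and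
`C_n ≤ 𝔖_n` the cyclic group generated by an `n`-cycle `σ`, the orbit-counting generating
function satisfies `n · X(C_n, q) = ∑_{d ∣ n} φ(d) (1 + q^d)^{n/d}`, and `n` times the number
of self-complementary necklaces equals `∑_{d ∣ n, d even} φ(d) 2^{n/d}`. -/
theorem necklace_generating_function (n : ℕ) (hn : 2 < n) (σ : Equiv.Perm (Fin n))
    (hcyc : σ.IsCycle) (hsupp : σ.support = Finset.univ) :
    ((n : Polynomial ℤ) *
        ∑ Ω : orbitRel.Quotient (Subgroup.zpowers σ) (Finset (Fin n)),
          (Polynomial.X : Polynomial ℤ) ^ (Quotient.out Ω).card =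
      ∑ d ∈ n.divisors,
        (Nat.totient d : Polynomial ℤ) * (1 + Polynomial.X ^ d) ^ (n / d)) ∧
    n * Nat.card {Ω : orbitRel.Quotient (Subgroup.zpowers σ) (Finset (Fin n)) //
          (fun S => (Finset.univ : Finset (Fin n)) \ S) ''
              orbit (Subgroup.zpowers σ) (Quotient.out Ω) =
            orbit (Subgroup.zpowers σ) (Quotient.out Ω)} =
      ∑ d ∈ n.divisors.filter (fun d => Even d), Nat.totient d * 2 ^ (n / d) := by
  have hcardG : Fintype.card (Subgroup.zpowers σ) = n := by
    rw [Fintype.card_zpowers, hcyc.orderOf, hsupp, Finset.card_univ, Fintype.card_fin]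
  have : Nonempty (Fin n) := ⟨⟨0, by lia⟩⟩
  have hfree : ∀ (g : Subgroup.zpowers σ) (k : ℤ) x,
      ((g : Equiv.Perm (Fin n)) ^ k) x = x → (g : Equiv.Perm (Fin n)) ^ k = 1 := fun g k x hx =>
    hcyc.eq_one_of_mem_zpowers_of_apply_eq hsupp (zpow_mem g.2 k) hx
  constructor
  · have hB := sum_sum_filter_smul_eq (G := Subgroup.zpowers σ) (X := Finset (Fin n)) id
      (fun _ _ => rfl) (fun S => (Polynomial.X : Polynomial ℤ) ^ S.card)
      (fun g S => by rw [Finset.card_smul_finset])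
    simp only [id_eq, mem_orbit_self, Finset.filter_true, hcardG] at hB
    have hC := IsCyclic.sum_orderOf (G := Subgroup.zpowers σ) fun d =>
      (1 + (Polynomial.X : Polynomial ℤ) ^ d) ^ (n / d)
    rw [hcardG] at hC
    rw [← hB, ← hC]
    refine Finset.sum_congr rfl fun g _ => ?_
    have h := sum_pow_card_filter_smul_eq_self (hfree g) (Polynomial.X : Polynomial ℤ)
    rw [Fintype.card_fin, Subgroup.orderOf_coe] at h
    exact h
  · have hcompl : ∀ (g : Subgroup.zpowers σ) (S : Finset (Fin n)), (g • S)ᶜ = g • Sᶜ :=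
      fun g S => (Equiv.Perm.smul_finset_compl (g : Equiv.Perm (Fin n)) S).symm
    have hB := sum_sum_filter_smul_eq (G := Subgroup.zpowers σ) (X := Finset (Fin n))
      (fun S => Sᶜ) hcompl (fun _ => 1) (fun _ _ => rfl) (R := ℕ)
    have hiff : ∀ S : Finset (Fin n),
        (fun S => (Finset.univ : Finset (Fin n)) \ S) '' orbit (Subgroup.zpowers σ) S =
          orbit (Subgroup.zpowers σ) S ↔ Sᶜ ∈ orbit (Subgroup.zpowers σ) S := by
      intro S
      simp only [← Finset.compl_eq_univ_sdiff]
      constructor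
      · intro h
        rw [← h]
        exact ⟨S, mem_orbit_self S, rfl⟩
      · intro h
        have hmaps : ∀ T ∈ orbit (Subgroup.zpowers σ) S, Tᶜ ∈ orbit (Subgroup.zpowers σ) S := by
          rintro _ ⟨g, rfl⟩
          change (g • S)ᶜ ∈ _
          rw [hcompl]
          exact mem_orbit_of_mem_orbit g h
        exact Set.Subset.antisymm (Set.image_subset_iff.2 hmaps)
          fun T hT => ⟨Tᶜ, hmaps T hT, compl_compl T⟩
    simp only [hiff]
    rw [Nat.card_eq_fintype_card, Fintype.card_subtype]
    simp only [Finset.sum_const, smul_eq_mul, mul_one, hcardG, Nat.cast_id] at hB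
    rw [← hB, Finset.sum_filter]
    have h := IsCyclic.sum_orderOf (G := Subgroup.zpowers σ) (R := ℕ) fun d =>
      if Even d then 2 ^ (n / d) else 0
    simp only [hcardG, Nat.cast_id, mul_ite, mul_zero] at h
    rw [← h]
    refine Finset.sum_congr rfl fun g _ => ?_
    have h' := card_filter_smul_eq_compl (hfree g)
    rw [Fintype.card_fin, Subgroup.orderOf_coe] at h'
    convert h'
    rfl
end
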